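/- arXiv:math/0509377 — 6 statements merged into one kernel-verified Lean document; each statement's English description precedes it below -/
import Mathlib

section
/- Let M be a maximal subgroup of a finite group G. If K₁/L₁ and K₂/L₂ are two chief factors of G with L₁ ≤ M, K₁ not contained in M, L₂ ≤ M, and K₂ not contained in M, then the groups (M ∩ K₁)/L₁ and (M ∩ K₂)/L₂ are isomorphic. In other words, the c-section of M is unique up to isomorphism. -/
/-- `K/L` is a chief factor of `G`: both are normal in `G`, `L < K`, and no normal
subgroup of `G` lies strictly between them. -/
def IsChiefFactor {G : Type*} [Group G] (L K : Subgroup G) : Prop :=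
  L.Normal ∧ K.Normal ∧ L < K ∧
    ∀ N : Subgroup G, N.Normal → L < N → N < K → False

/-- If `A` supplements the normal subgroup `L` in `B`, then `B / L` is the quotient of `A` by
its intersection with `L`, here cut out by a possibly larger normal subgroup `C`. -/
theorem nonempty_mulEquiv_quotient_of_le_sup {G : Type*} [Group G] (A B C L : Subgroup G)
    [C.Normal] [L.Normal] (hAB : A ≤ B) (hB : B ≤ A ⊔ L) (hC : A ⊓ C = A ⊓ L) :
    Nonempty ((A ⧸ C.subgroupOf A) ≃* (B ⧸ L.subgroupOf B)) := by
  let f : A →* B ⧸ L.subgroupOf B :=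
    (QuotientGroup.mk' (L.subgroupOf B)).comp (Subgroup.inclusion hAB)
  have hker : C.subgroupOf A = f.ker := by
    ext ⟨x, hx⟩
    have h : x ∈ A ⊓ C ↔ x ∈ A ⊓ L := by rw [hC]
    simpa [f, MonoidHom.mem_ker, Subgroup.mem_subgroupOf, hx] using h
  have hsurj : Function.Surjective f := by
    intro q
    obtain ⟨⟨b, hb⟩, rfl⟩ := QuotientGroup.mk'_surjective _ q
    obtain ⟨a, ha, l, hl, rfl⟩ := Subgroup.mem_sup_of_normal_right.mp (hB hb)
    refine ⟨⟨a, ha⟩, QuotientGroup.eq.mpr ?_⟩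
    simpa [Subgroup.mem_subgroupOf] using hl
  exact ⟨(QuotientGroup.quotientMulEquivOfEq hker).trans
    (QuotientGroup.quotientKerEquivOfSurjective f hsurj)⟩

/-- A chief factor `K/L` has no normal subgroup of `G` strictly between its terms. -/
theorem IsChiefFactor.eq_or_eq {G : Type*} [Group G] {L K N : Subgroup G}
    (h : IsChiefFactor L K) (hN : N.Normal) (hLN : L ≤ N) (hNK : N ≤ K) : N = L ∨ N = K := by
  by_contra! hne
  exact h.2.2.2 N hN (hLN.lt_of_ne' hne.1) (hNK.lt_of_ne hne.2)

/-- A chief factor `K/L` avoided by `M` satisfies `K ∩ core M = L`. -/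
theorem IsChiefFactor.inf_normalCore_eq {G : Type*} [Group G] {M L K : Subgroup G}
    (h : IsChiefFactor L K) (hL : L ≤ M) (hK : ¬K ≤ M) : K ⊓ M.normalCore = L := by
  have := h.1
  have := h.2.1
  refine (h.eq_or_eq inferInstance
    (le_inf h.2.2.1.le (Subgroup.normal_le_normalCore.mpr hL)) inf_le_left).resolve_right ?_
  intro he
  exact hK ((inf_eq_left.mp he).trans M.normalCore_le)

/-- If two chief factors avoided by a maximal subgroup `M` have tops meeting inside the core
of `M`, then the corresponding c-sections are trivial. -/
theorem IsChiefFactor.inf_le_of_inf_le_normalCore {G : Type*} [Group G] {M L K N : Subgroup G}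
    (hM : IsCoatom M) (h : IsChiefFactor L K) (hL : L ≤ M) (hK : ¬K ≤ M) (hN : N.Normal)
    (hNM : ¬N ≤ M) (hKN : K ⊓ N ≤ M.normalCore) : M ⊓ K ≤ L := by
  have hKn := h.2.1
  have hconj : ∀ g ∈ N, ∀ x ∈ M ⊓ K, g * x * g⁻¹ ∈ M ⊓ K := by
    rintro g hg x ⟨hxM, hxK⟩
    have hc : g * x * g⁻¹ * x⁻¹ ∈ M := by
      refine M.normalCore_le (hKN ⟨K.mul_mem (hKn.conj_mem x hxK g) (K.inv_mem hxK), ?_⟩)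
      simpa [mul_assoc] using N.mul_mem hg (hN.conj_mem _ (N.inv_mem hg) x)
    exact ⟨by simpa using M.mul_mem hc hxM, hKn.conj_mem x hxK g⟩
  have hMn : M ≤ Subgroup.normalizer (M ⊓ K : Subgroup G) :=
    fun g hg ↦ Subgroup.mem_normalizer_iff.mpr fun x ↦
      and_congr (by simp [Subgroup.mul_mem_cancel_right, Subgroup.mul_mem_cancel_left, hg])
        ⟨fun hx ↦ hKn.conj_mem x hx g,
          fun hx ↦ by simpa [mul_assoc] using hKn.conj_mem _ hx g⁻¹⟩
  have hNn : N ≤ Subgroup.normalizer (M ⊓ K : Subgroup G) :=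
    fun g hg ↦ Subgroup.mem_normalizer_iff.mpr fun x ↦
      ⟨hconj g hg x, fun hx ↦ by simpa [mul_assoc] using hconj g⁻¹ (N.inv_mem hg) _ hx⟩
  have htop : Subgroup.normalizer (M ⊓ K : Subgroup G) = ⊤ :=
    hM.2 _ (hMn.lt_of_not_ge fun hle ↦ hNM (hNn.trans hle))
  have : (M ⊓ K).Normal := Subgroup.normalizer_eq_top_iff.mp htop
  rw [← h.inf_normalCore_eq hL hK]
  exact le_inf inf_le_right (Subgroup.normal_le_normalCore.mpr inf_le_left)

/-- A normal subgroup `D ≤ K` outside the core of `M` supplements `L` in every chief factor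
`K/L` avoided by `M`, also after intersecting with `M`. -/
theorem IsChiefFactor.inf_le_sup {G : Type*} [Group G] {M L K D : Subgroup G}
    (h : IsChiefFactor L K) (hL : L ≤ M) (hD : D.Normal) (hDK : D ≤ K)
    (hDM : ¬D ≤ M.normalCore) : M ⊓ K ≤ (M ⊓ D) ⊔ L := by
  have := h.1
  have hsup : D ⊔ L = K := by
    refine (h.eq_or_eq inferInstance le_sup_right (sup_le hDK h.2.2.1.le)).resolve_left ?_
    intro he
    exact hDM ((sup_eq_right.mp he).trans (Subgroup.normal_le_normalCore.mpr hL))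
  rintro x ⟨hxM, hxK⟩
  rw [← hsup] at hxK
  obtain ⟨d, hd, l, hl, rfl⟩ := Subgroup.mem_sup_of_normal_right.mp hxK
  exact Subgroup.mul_mem_sup ⟨(M.mul_mem_cancel_right (hL hl)).mp hxM, hd⟩ hl

/-- Any two c-sections of a maximal subgroup `M` of a finite group `G` are isomorphic. -/
theorem statement1 {G : Type*} [Group G] [Finite G] (M : Subgroup G) (hM : IsCoatom M)
    (L₁ K₁ L₂ K₂ : Subgroup G)
    (hcf₁ : IsChiefFactor L₁ K₁) (hcf₂ : IsChiefFactor L₂ K₂)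
    (hL₁ : L₁ ≤ M) (hK₁ : ¬K₁ ≤ M) (hL₂ : L₂ ≤ M) (hK₂ : ¬K₂ ≤ M) :
    haveI : L₁.Normal := hcf₁.1
    haveI : L₂.Normal := hcf₂.1
    Nonempty ((↥(M ⊓ K₁) ⧸ L₁.subgroupOf (M ⊓ K₁)) ≃*
      (↥(M ⊓ K₂) ⧸ L₂.subgroupOf (M ⊓ K₂))) := by
  have := hcf₁.1
  have := hcf₂.1
  have := hcf₁.2.1
  have := hcf₂.2.1
  have hC₁ := hcf₁.inf_normalCore_eq hL₁ hK₁
  have hC₂ := hcf₂.inf_normalCore_eq hL₂ hK₂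
  suffices ∃ A : Subgroup G, (A ≤ M ⊓ K₁ ∧ M ⊓ K₁ ≤ A ⊔ L₁) ∧ A ≤ M ⊓ K₂ ∧ M ⊓ K₂ ≤ A ⊔ L₂ by
    obtain ⟨A, ⟨hA₁, hs₁⟩, hA₂, hs₂⟩ := this
    obtain ⟨e₁⟩ := nonempty_mulEquiv_quotient_of_le_sup A _ M.normalCore L₁ hA₁ hs₁ (by
      rw [← hC₁, ← inf_assoc, inf_eq_left.mpr (hA₁.trans inf_le_right)])
    obtain ⟨e₂⟩ := nonempty_mulEquiv_quotient_of_le_sup A _ M.normalCore L₂ hA₂ hs₂ (by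
      rw [← hC₂, ← inf_assoc, inf_eq_left.mpr (hA₂.trans inf_le_right)])
    exact ⟨e₁.symm.trans e₂⟩
  by_cases hD : K₁ ⊓ K₂ ≤ M.normalCore
  · refine ⟨⊥, ⟨bot_le, ?_⟩, bot_le, ?_⟩
    · rw [bot_sup_eq]
      exact hcf₁.inf_le_of_inf_le_normalCore hM hL₁ hK₁ ‹_› hK₂ hD
    · rw [bot_sup_eq]
      exact hcf₂.inf_le_of_inf_le_normalCore hM hL₂ hK₂ ‹_› hK₁ (inf_comm K₁ K₂ ▸ hD)
  · exact ⟨M ⊓ (K₁ ⊓ K₂),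
      ⟨inf_le_inf_left M inf_le_left, hcf₁.inf_le_sup hL₁ inferInstance inf_le_left hD⟩,
      inf_le_inf_left M inf_le_right, hcf₂.inf_le_sup hL₂ inferInstance inf_le_right hD⟩
end

section
/- Let n be a natural number with n ≠ 4, and let k satisfy 1 < k < n. Then the alternating group A_n has no subgroup of index k. -/
open scoped Nat in
/-- A simple group embeds into the group of permutations of the cosets of any proper subgroup. -/
theorem IsSimpleGroup.card_le_factorial_index {G : Type*} [Group G] [IsSimpleGroup G]
    {U : Subgroup G} [U.FiniteIndex] (hU : U ≠ ⊤) : Nat.card G ≤ U.index ! := by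
  have hcore : U.normalCore = ⊥ :=
    U.normalCore_normal.eq_bot_or_eq_top.resolve_right
      fun h ↦ hU (top_le_iff.mp (h ▸ U.normalCore_le))
  rw [Subgroup.normalCore_eq_ker, MonoidHom.ker_eq_bot_iff] at hcore
  rw [Subgroup.index, ← Nat.card_perm]
  exact Nat.card_le_card_of_injective _ hcore

/-- For `n ≠ 4` and `1 < k < n`, the alternating group `Aₙ` has no subgroup of index `k`. -/
theorem statement2 (n k : ℕ) (hn : n ≠ 4) (hk1 : 1 < k) (hkn : k < n)
    (U : Subgroup (alternatingGroup (Fin n))) : U.index ≠ k := by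
  intro hU
  have : Nontrivial (Fin n) := Fin.nontrivial_iff_two_le.mpr (by omega)
  have hcard := two_mul_nat_card_alternatingGroup (α := Fin n)
  rw [Nat.card_perm, Nat.card_fin] at hcard
  obtain rfl | h5 : n = 3 ∨ 5 ≤ n := by omega
  · obtain rfl : k = 2 := by omega
    have hdvd := U.index_dvd_card
    have hcard3 : Nat.card (alternatingGroup (Fin 3)) = 3 :=
      Nat.eq_of_mul_eq_mul_left two_pos hcard
    rw [hU, hcard3] at hdvd
    norm_num at hdvd
  · have : IsSimpleGroup (alternatingGroup (Fin n)) :=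
      alternatingGroup.isSimpleGroup (by simpa using h5)
    have hne : U ≠ ⊤ := by
      rintro rfl
      rw [Subgroup.index_top] at hU
      omega
    have hle := IsSimpleGroup.card_le_factorial_index hne
    rw [hU] at hle
    have hmono : k.factorial ≤ (n - 1).factorial := Nat.factorial_le (by omega)
    rw [← Nat.mul_factorial_pred (by omega : n ≠ 0)] at hcard
    nlinarith [Nat.factorial_pos (n - 1)]
end

section
/- Let n ≥ 5 with n ≠ 6. Then any two subgroups of index n in the alternating group A_n are conjugate in A_n. -/
section ExceptSix

open Equiv Equiv.Perm

theorem exists_apply_eq_of_sq_mul_eq_one {α : Type*} {c d : α → α} {a b x p q r : α}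
    (hab : a ≠ b) (hbx : b ≠ x) (hxa : x ≠ a) (ca : c a = b) (cb : c b = x) (cx : c x = a)
    (cz : ∀ z, z ≠ a → z ≠ b → z ≠ x → c z = z)
    (hpq : p ≠ q) (hqr : q ≠ r) (hrp : r ≠ p) (dp : d p = q) (dq : d q = r) (dr : d r = p)
    (dz : ∀ z, z ≠ p → z ≠ q → z ≠ r → d z = z)
    (h : ∀ z, c (d (c (d z))) = z) (hne : ∃ z, c (d z) ≠ z) :
    ∃ z, c z = d z ∧ c z ≠ z := by
  by_contra! H
  have e1 := h a; have e2 := h b; have e3 := h x; have := h p; have := h q; have := h r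
  have f1 := H a; have f2 := H b; have f3 := H x
  have hc (z) : z = a ∨ z = b ∨ z = x ∨ c z = z := by grind
  have hd (z) : z = p ∨ z = q ∨ z = r ∨ d z = z := by grind
  have cp := hc p; have cq := hc q; have cr := hc r
  have da := hd a; have db := hd b; have dx := hd x
  have hne' : c (d p) ≠ p ∨ c (d q) ≠ q ∨ c (d r) ≠ r ∨ c (d a) ≠ a ∨ c (d b) ≠ b ∨ c (d x) ≠ x := by
    obtain ⟨z, hz⟩ := hne
    by_contra! hh
    have hcz := hc z
    have hdz := hd z
    clear cz dz h H hc hd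
    rcases hdz with rfl | rfl | rfl | hd
    · exact hz hh.1
    · exact hz hh.2.1
    · exact hz hh.2.2.1
    · grind
  clear cz dz h H hne hc hd
  rcases eq_or_ne p a with rfl | h1
  · grind (splits := 40)
  rcases eq_or_ne p b with rfl | h2
  · grind (splits := 40)
  rcases eq_or_ne p x with rfl | h3
  · grind (splits := 40)
  rcases eq_or_ne q a with rfl | h4
  · grind (splits := 40)
  rcases eq_or_ne q b with rfl | h5
  · grind (splits := 40)
  rcases eq_or_ne q x with rfl | h6
  · grind (splits := 40)
  grind (splits := 40)

theorem Equiv.Perm.IsThreeCycle.apply_ne_and_eq {α : Type*} [Fintype α] [DecidableEq α]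
    {c : Perm α} (hc : c.IsThreeCycle) {a : α} (ha : c a ≠ a) :
    a ≠ c a ∧ c a ≠ c (c a) ∧ c (c a) ≠ a ∧ c (c (c a)) = a ∧
      ∀ z, z ≠ a → z ≠ c a → z ≠ c (c a) → c z = z := by
  have h1 := hc.nodup_iff_mem_support.2 (mem_support.2 ha)
  have h2 := hc.support_eq_iff_mem_support.2 (mem_support.2 ha)
  have h3 : c (c (c a)) = a := by
    have := congrArg (· a) (hc.orderOf ▸ pow_orderOf_eq_one c)
    simpa [pow_succ] using this
  refine ⟨ha.symm, by grind, by grind, h3, fun z h4 h5 h6 => ?_⟩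
  rw [← notMem_support, h2]
  simp [h4, h5, h6]

theorem Equiv.Perm.IsThreeCycle.apply_eq_self {α : Type*} [Fintype α] [DecidableEq α]
    {c d : Perm α} (hc : c.IsThreeCycle) (hd : d.IsThreeCycle) (hcd : c ≠ d) {a : α}
    (h : c a = d a) (ha : c a ≠ a) : d (c (c a)) = c (c a) := by
  obtain ⟨c1, c2, c3, c4, c5⟩ := hc.apply_ne_and_eq ha
  obtain ⟨d1, d2, d3, d4, d5⟩ := hd.apply_ne_and_eq (h ▸ ha)
  refine d5 _ c3 (h ▸ c2.symm) fun h' => hcd (Equiv.ext fun z => ?_)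
  have := c5 z
  have := d5 z
  clear c5 d5 hcd
  by_cases z = a <;> by_cases z = c a <;> by_cases z = c (c a) <;> grind

theorem Equiv.Perm.IsThreeCycle.apply_eq_of_common_edges {α : Type*} [Fintype α]
    [DecidableEq α] {c d e : Perm α} (hc : c.IsThreeCycle) (hd : d.IsThreeCycle)
    (he : e.IsThreeCycle) (hcd : c ≠ d) {a y z : α} (h : c a = d a) (ha : c a ≠ a)
    (hy : e y = c y) (hy' : c y ≠ y) (hz : e z = d z) (hz' : d z ≠ z) : e a = c a := by
  have h1 := hc.apply_eq_self hd hcd h ha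
  obtain ⟨c1, c2, c3, c4, c5⟩ := hc.apply_ne_and_eq ha
  obtain ⟨d1, d2, d3, d4, d5⟩ := hd.apply_ne_and_eq (h ▸ ha)
  obtain ⟨e1, e2, e3, e4, e5⟩ := he.apply_ne_and_eq (hy ▸ hy')
  have hy2 : y = a ∨ y = c a ∨ y = c (c a) := by
    by_contra! H
    exact hy' (c5 y H.1 H.2.1 H.2.2)
  have hz2 : z = a ∨ z = d a ∨ z = d (d a) := by
    by_contra! H
    exact hz' (d5 z H.1 H.2.1 H.2.2)
  have e6 := e5 z
  have e7 := e.injective.eq_iff (a := y) (b := z)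
  clear c5 d5 e5 hcd hc hd he
  obtain ⟨b, hb⟩ : ∃ b, c a = b := ⟨_, rfl⟩
  have hda := h.symm.trans hb
  clear h
  rw [hb] at ha h1 c1 c2 c3 c4 hy2 ⊢
  rw [hda] at d1 d2 d3 d4 hz2
  have hxy : d b ≠ c b := by grind
  rcases hy2 with rfl | rfl | rfl <;> rcases hz2 with rfl | rfl | rfl <;> grind

theorem mem_of_threeCycles {α : Type*} [Fintype α] [DecidableEq α] (H : Subgroup (Perm α))
    {a b : α} (hab : a ≠ b) {s : Set α}
    (hs : ∀ i ∈ s, i ≠ a → i ≠ b → swap a i * swap a b ∈ H) :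
    ∀ (k : ℕ) (g : Perm α), (Finset.univ.filter fun i => i ≠ a ∧ i ≠ b ∧ g i ≠ i).card = k →
      sign g = 1 → (∀ i, g i ≠ i → i = a ∨ i = b ∨ i ∈ s) → g ∈ H := by
  intro k
  induction k using Nat.strong_induction_on with
  | _ k ih =>
  intro g hk hg hgs
  by_cases h : ∀ i, i ≠ a → i ≠ b → g i = i
  · by_cases ha : g a = a
    · have : g = 1 := by
        ext i
        have : g b = b := by
          by_contra hb
          have := h (g b)
          grind [g.injective.eq_iff]
        by_cases i = a <;> by_cases i = b <;> simp_all
      simp [this]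
    · have : g = swap a b := by
        ext i
        have := h (g a)
        have := h (g b)
        have := h i
        grind [g.injective.eq_iff]
      simp [this, hab] at hg
  · push Not at h
    obtain ⟨i, hia, hib, hi⟩ := h
    have his : i ∈ s := by grind
    have hci := hs i his hia hib
    obtain ⟨h, hH, hsign, hj, hfix⟩ : ∃ h ∈ H, sign h = 1 ∧ h (g i) = i ∧
        ∀ z, z ≠ a → z ≠ b → z ≠ i → z ≠ g i → h z = z := by
      by_cases h1 : g i = a
      · refine ⟨_, H.mul_mem hci hci, ?_, ?_, ?_⟩
        · simp [hab, hia.symm]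
        · simp only [Perm.mul_apply]; grind
        · intro z _ _ _ _; simp only [Perm.mul_apply]; grind
      by_cases h2 : g i = b
      · refine ⟨_, hci, ?_, ?_, ?_⟩
        · simp [hab, hia.symm]
        · simp only [Perm.mul_apply]; grind
        · intro z _ _ _ _; simp only [Perm.mul_apply]; grind
      have hjs : g i ∈ s := by
        have := hgs (g i)
        grind [g.injective.eq_iff]
      refine ⟨_, H.mul_mem (H.mul_mem hci hci) (hs _ hjs h1 h2), ?_, ?_, ?_⟩
      · simp [hab, hia.symm, Ne.symm h1]
      · simp only [Perm.mul_apply]; grind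
      · intro z _ _ _ _; simp only [Perm.mul_apply]; grind
    have := ih _ ?_ (h * g) rfl ?_ ?_
    · exact (H.mul_mem_cancel_left hH).1 this
    · rw [← hk]
      apply Finset.card_lt_card
      rw [Finset.ssubset_iff_of_subset]
      · refine ⟨i, ?_, ?_⟩
        · simp [*]
        · rw [Finset.mem_filter]
          simp [*]
      · intro z
        have := hfix z
        rw [Finset.mem_filter, Finset.mem_filter, Perm.mul_apply]
        clear ih hk
        simp only [Finset.mem_univ, true_and]
        grind [g.injective.eq_iff]
    · simp [hsign, hg]
    · intro z
      simp only [Perm.mul_apply]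
      have := hfix z
      have := hgs z
      have := hgs (g i)
      grind [g.injective.eq_iff]

theorem factorial_gt_of_three_le {k : ℕ} (hk : 3 ≤ k) :
    2 * (3 ^ k * k.factorial) < (3 * k - 3).factorial * 3 := by
  induction k, hk using Nat.le_induction with
  | base => decide
  | succ k hk ih =>
    obtain ⟨m, rfl⟩ : ∃ m, k = m + 1 := ⟨k - 1, by omega⟩
    rw [show 3 * (m + 1 + 1) - 3 = 3 * m + 2 + 1 by omega,
      Nat.factorial_succ (3 * m + 2), Nat.factorial_succ (3 * m + 1), Nat.factorial_succ (3 * m),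
      Nat.factorial_succ (m + 1), pow_succ]
    rw [show 3 * (m + 1) - 3 = 3 * m by omega] at ih
    have h1 : 3 * (m + 1 + 1) ≤ (3 * m + 2 + 1) * ((3 * m + 1 + 1) * (3 * m + 1)) := by
      ring_nf
      nlinarith [sq_nonneg m, Nat.zero_le (m ^ 3)]
    have h2 := Nat.mul_lt_mul_of_lt_of_le ih h1 (by positivity)
    linarith

theorem two_mul_centralizer_lt {n k : ℕ} (hn : n ≠ 6) (hk : 2 ≤ k) (hkn : 3 * k ≤ n) :
    2 * ((n - 3 * k).factorial * 3 ^ k * k.factorial) < (n - 3).factorial * 3 := by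
  obtain rfl | hk := hk.eq_or_lt
  · obtain ⟨m, rfl⟩ : ∃ m, n = m + 7 := ⟨n - 7, by omega⟩
    rw [show m + 7 - 3 * 2 = m + 1 by omega, show m + 7 - 3 = m + 1 + 1 + 1 + 1 by omega,
      Nat.factorial_succ (m + 3), Nat.factorial_succ (m + 2), Nat.factorial_succ (m + 1)]
    have h1 : 12 < (m + 3 + 1) * ((m + 2 + 1) * (m + 1 + 1)) :=
      lt_of_lt_of_le (by norm_num : 12 < 4 * (3 * 2)) <|
        Nat.mul_le_mul (by omega) (Nat.mul_le_mul (by omega) (by omega))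
    have h2 := Nat.mul_lt_mul_of_pos_right h1 (m + 1).factorial_pos
    simp only [Nat.factorial_two]
    linarith
  · have h1 := Nat.le_of_dvd (Nat.factorial_pos _)
      (Nat.factorial_mul_factorial_dvd_factorial_add (n - 3 * k) (3 * k - 3))
    rw [show n - 3 * k + (3 * k - 3) = n - 3 by omega] at h1
    have h2 := Nat.mul_lt_mul_of_pos_left (factorial_gt_of_three_le hk)
      (n - 3 * k).factorial_pos
    linarith

theorem nat_card_centralizer_le {α : Type*} [Fintype α] [DecidableEq α] [Nontrivial α]
    (c : alternatingGroup α) :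
    Nat.card (Subgroup.centralizer {(c : Perm α)}) ≤
      2 * Nat.card (Subgroup.centralizer {c}) := by
  set C := Subgroup.centralizer {(c : Perm α)}
  have h1 := (((alternatingGroup α).subgroupOf C)).card_mul_index
  have h2 : ((alternatingGroup α).subgroupOf C).index ≤ 2 :=
    Nat.le_of_dvd two_pos
      (alternatingGroup.index_eq_two (α := α) ▸ Subgroup.relIndex_dvd_index_of_normal _ C)
  have h3 : Nat.card ((alternatingGroup α).subgroupOf C) ≤
      Nat.card (Subgroup.centralizer {c}) := by
    refine Nat.card_le_card_of_injective
      (fun g => ⟨⟨g.1.1, g.2⟩, Subgroup.mem_centralizer_singleton_iff.2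
        (Subtype.ext (Subgroup.mem_centralizer_singleton_iff.1 g.1.2))⟩) fun g h hgh => ?_
    exact Subtype.ext (Subtype.ext (congrArg (fun z => (z.1.1 : Perm α)) hgh))
  rw [← h1, mul_comm]
  exact Nat.mul_le_mul h2 h3

theorem nat_card_centralizer_map_le {G K : Type*} [Group G] [Group K] [Finite K] (f : G →* K)
    (hf : Function.Injective f) (c : G) :
    Nat.card (Subgroup.centralizer {c}) ≤ Nat.card (Subgroup.centralizer {f c}) := by
  refine Nat.card_le_card_of_injective
    (fun g => ⟨f g.1, Subgroup.mem_centralizer_singleton_iff.2 ?_⟩) fun g h hgh => ?_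
  · rw [← map_mul, Subgroup.mem_centralizer_singleton_iff.1 g.2, map_mul]
  · exact Subtype.ext (hf (congrArg Subtype.val hgh))

theorem isThreeCycle_map {α β : Type*} [Fintype α] [DecidableEq α] [Fintype β] [DecidableEq β]
    (hcard : Fintype.card β = Fintype.card α) (h6 : Fintype.card α ≠ 6)
    (f : alternatingGroup α →* Perm β) (hf : Function.Injective f) {c : alternatingGroup α}
    (hc : (c : Perm α).IsThreeCycle) : (f c).IsThreeCycle := by
  have hord : orderOf (f c) = 3 := by
    rw [orderOf_injective f hf, ← Subgroup.orderOf_coe, hc.orderOf]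
  obtain ⟨k, hk⟩ := cycleType_prime_order (hord ▸ Nat.prime_three)
  rw [hord] at hk
  rcases k with _ | k
  · rw [IsThreeCycle]
    simpa using hk
  obtain ⟨K, hK, hkK⟩ : ∃ K, 2 ≤ K ∧ k + 1 + 1 = K := ⟨_, Nat.le_add_left 2 k, rfl⟩
  rw [hkK] at hk
  have hle : 3 * K ≤ Fintype.card α := by
    have := (f c).support.card_le_univ
    rw [← sum_cycleType, hk] at this
    simp at this
    omega
  have : Nontrivial α := Fintype.one_lt_card_iff_nontrivial.1 (by omega)
  have h1 := nat_card_centralizer_le c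
  have h2 := nat_card_centralizer_map_le f hf c
  rw [Equiv.Perm.nat_card_centralizer, hc.cycleType] at h1
  rw [Equiv.Perm.nat_card_centralizer (f c), hk, hcard] at h2
  have h3 := two_mul_centralizer_lt h6 hK hle
  have hK0 : K ≠ 0 := by omega
  simp [Multiset.toFinset_replicate, hK0] at h1 h2
  rw [mul_comm K 3] at h2
  omega

theorem swap_mul_swap_sq_eq_one {α : Type*} [DecidableEq α] {u v i j : α} (huv : u ≠ v)
    (hiu : i ≠ u) (hiv : i ≠ v) (hju : j ≠ u) (hjv : j ≠ v) (hij : i ≠ j) :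
    swap u i * swap u v * (swap u j * swap u v * (swap u i * swap u v * (swap u j * swap u v)))
      = 1 := by
  have key {k : α} (hku : k ≠ u) (hkv : k ≠ v) : (swap u k * swap u v) u = v ∧
      (swap u k * swap u v) v = k ∧ (swap u k * swap u v) k = u ∧
      ∀ z, z ≠ u → z ≠ v → z ≠ k → (swap u k * swap u v) z = z := by
    simp only [Perm.mul_apply]
    grind
  have hi := key hiu hiv
  have hj := key hju hjv
  clear key
  generalize swap u i * swap u v = c at *
  generalize swap u j * swap u v = d at *
  obtain ⟨cu, cv, ci, hc⟩ := hi
  obtain ⟨du, dv, dj, hd⟩ := hj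
  have cj := hc j hju hjv hij.symm
  have di := hd i hiu hiv hij
  ext z
  simp only [Perm.mul_apply, Perm.one_apply]
  rcases eq_or_ne z u with rfl | h1
  · simp [*]
  rcases eq_or_ne z v with rfl | h2
  · simp [*]
  rcases eq_or_ne z i with rfl | h3
  · simp [*]
  rcases eq_or_ne z j with rfl | h4
  · simp [*]
  simp [hc z h1 h2 h3, hd z h1 h2 h4]

theorem exists_map_fixed {α β : Type*} [Fintype α] [DecidableEq α] [Fintype β] [DecidableEq β]
    (hcard : Fintype.card β = Fintype.card α) (h5 : 5 ≤ Fintype.card α) (h6 : Fintype.card α ≠ 6)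
    (f : alternatingGroup α →* Perm β) (hf : Function.Injective f) (m : α) :
    ∃ x : β, ∀ g : alternatingGroup α, (g : Perm α) m = m → f g x = x := by
  have hex (s : Finset α) (hs : s.card < 5) : ∃ x, x ∉ s := by
    by_contra! H
    rw [Finset.eq_univ_iff_forall.2 H, Finset.card_univ] at hs
    omega
  obtain ⟨u, hum⟩ : ∃ u, u ≠ m := by
    simpa using hex {m} (by simp)
  obtain ⟨v, hvm, hvu⟩ : ∃ v, v ≠ m ∧ v ≠ u := by
    simpa using hex {m, u} (Finset.card_le_two.trans_lt (by norm_num))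
  have huv := hvu.symm
  have tc {i : α} (hu : i ≠ u) (hv : i ≠ v) : (swap u i * swap u v).IsThreeCycle :=
    isThreeCycle_swap_mul_swap_same hu.symm huv hv
  let t (i : α) : alternatingGroup α :=
    if h : i ≠ u ∧ i ≠ v then ⟨swap u i * swap u v, (tc h.1 h.2).mem_alternatingGroup⟩ else 1
  have ht {i : α} (hu : i ≠ u) (hv : i ≠ v) : (t i : Perm α) = swap u i * swap u v := by
    simp [t, hu, hv]
  have hc {i : α} (hu : i ≠ u) (hv : i ≠ v) : (f (t i)).IsThreeCycle :=
    isThreeCycle_map hcard h6 f hf (by rw [ht hu hv]; exact tc hu hv)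
  have hmul {i j : α} (hiu : i ≠ u) (hiv : i ≠ v) (hju : j ≠ u) (hjv : j ≠ v) (hij : i ≠ j) :
      t i * (t j * (t i * t j)) = 1 ∧ t i * t j ≠ 1 := by
    constructor
    · apply Subtype.ext
      simp only [Subgroup.coe_mul, ht hiu hiv, ht hju hjv, OneMemClass.coe_one]
      exact swap_mul_swap_sq_eq_one huv hiu hiv hju hjv hij
    · intro h
      have := congrArg (fun g : alternatingGroup α => (g : Perm α) u) h
      simp only [Subgroup.coe_mul, ht hiu hiv, ht hju hjv, Perm.mul_apply] at this
      simp at this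
      grind
  have hshare {i j : α} (hiu : i ≠ u) (hiv : i ≠ v) (hju : j ≠ u) (hjv : j ≠ v) (hij : i ≠ j) :
      ∃ z, f (t i) z = f (t j) z ∧ f (t i) z ≠ z := by
    obtain ⟨a, ha⟩ := (hc hiu hiv).isCycle.nonempty_support
    obtain ⟨p, hp⟩ := (hc hju hjv).isCycle.nonempty_support
    obtain ⟨hab, hbx, hxa, cx, cz⟩ := (hc hiu hiv).apply_ne_and_eq (mem_support.1 ha)
    obtain ⟨hpq, hqr, hrp, dr, dz⟩ := (hc hju hjv).apply_ne_and_eq (mem_support.1 hp)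
    obtain ⟨h1, h2⟩ := hmul hiu hiv hju hjv hij
    refine exists_apply_eq_of_sq_mul_eq_one hab hbx hxa rfl rfl cx cz hpq hqr hrp rfl rfl dr dz ?_ ?_
    · intro z
      have := congrArg (fun g => f g z) h1
      simpa using this
    · by_contra! h
      apply h2
      apply hf
      ext z
      simpa using h z
  obtain ⟨w, hwu, hwv, hwm⟩ : ∃ w, w ≠ u ∧ w ≠ v ∧ w ≠ m := by
    simpa using hex {u, v, m} (Finset.card_le_three.trans_lt (by norm_num))
  obtain ⟨a, hac, ha⟩ := hshare hum.symm hvm.symm hwu hwv hwm.symm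
  have hne {i j : α} (hiu : i ≠ u) (hiv : i ≠ v) (hju : j ≠ u) (hjv : j ≠ v) (hij : i ≠ j) :
      f (t i) ≠ f (t j) := by
    intro h
    have := congrArg (fun g : alternatingGroup α => (g : Perm α) v) (hf h)
    simp only [ht hiu hiv, ht hju hjv, Perm.mul_apply] at this
    simp [hij] at this
  have hcm := hc hum.symm hvm.symm
  have hcw := hc hwu hwv
  have hmw := hne hum.symm hvm.symm hwu hwv hwm.symm
  have hedge {i : α} (hiu : i ≠ u) (hiv : i ≠ v) (him : i ≠ m) : f (t i) a = f (t m) a := by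
    obtain rfl | hiw := eq_or_ne i w
    · exact hac.symm
    obtain ⟨y, hy, hy'⟩ := hshare hiu hiv hum.symm hvm.symm him
    obtain ⟨z, hz, hz'⟩ := hshare hiu hiv hwu hwv hiw
    exact hcm.apply_eq_of_common_edges hcw (hc hiu hiv) hmw hac ha hy (hy ▸ hy') hz (hz ▸ hz')
  refine ⟨f (t m) (f (t m) a), fun g hg => ?_⟩
  let S := ((MulAction.stabilizer (Perm β) (f (t m) (f (t m) a))).comap f).map
    (alternatingGroup α).subtype
  have hgS : (g : Perm α) ∈ S := by
    refine mem_of_threeCycles S huv (s := {i | i ≠ m}) ?_ _ g rfl g.2 ?_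
    · intro i him hiu hiv
      refine ⟨t i, ?_, ht hiu hiv⟩
      exact hcm.apply_eq_self (hc hiu hiv) (hne hum.symm hvm.symm hiu hiv (Ne.symm him))
        (hedge hiu hiv him).symm ha
    · rintro i hi
      right; right
      rintro rfl
      exact hi hg
  obtain ⟨g', hg', h⟩ := hgS
  obtain rfl : g' = g := Subtype.ext h
  exact hg'

theorem exists_map_conj_eq_stabilizer {n : ℕ} (hn : 5 ≤ n) (hn6 : n ≠ 6)
    (U : Subgroup (alternatingGroup (Fin n))) (hU : U.index = n) (m : Fin n) :
    ∃ g : alternatingGroup (Fin n), U.map (MulAut.conj g).toMonoidHom =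
      MulAction.stabilizer (alternatingGroup (Fin n)) m := by
  have : IsSimpleGroup (alternatingGroup (Fin n)) := alternatingGroup.isSimpleGroup (by simpa)
  have : MulAction.IsPretransitive (alternatingGroup (Fin n)) (Fin n) :=
    alternatingGroup.isPretransitive_of_three_le_card (Fin n) (by simp; omega)
  have hcore : U.normalCore = ⊥ := by
    refine U.normalCore_normal.eq_bot_or_eq_top.resolve_right fun h => ?_
    have := top_unique (h ▸ U.normalCore_le)
    rw [this, Subgroup.index_top] at hU
    omega
  have hcard : Nat.card (alternatingGroup (Fin n) ⧸ U) = n := hU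
  have : Finite (alternatingGroup (Fin n) ⧸ U) := inferInstance
  have := Fintype.ofFinite (alternatingGroup (Fin n) ⧸ U)
  classical
  rw [Nat.card_eq_fintype_card] at hcard
  obtain ⟨x, hx⟩ := exists_map_fixed (by simpa using hcard) (by simpa) (by simpa)
    (MulAction.toPermHom (alternatingGroup (Fin n)) (alternatingGroup (Fin n) ⧸ U))
    ((MonoidHom.ker_eq_bot_iff _).1 (U.normalCore_eq_ker ▸ hcore)) m
  obtain ⟨g, rfl⟩ := QuotientGroup.mk_surjective x
  refine ⟨g, ?_⟩
  have hst : MulAction.stabilizer (alternatingGroup (Fin n))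
      (g : alternatingGroup (Fin n) ⧸ U) = U.map (MulAut.conj g).toMonoidHom := by
    have := MulAction.stabilizer_smul_eq_stabilizer_map_conj g
      ((1 : alternatingGroup (Fin n)) : alternatingGroup (Fin n) ⧸ U)
    rw [MulAction.stabilizer_quotient] at this
    simpa using this
  rw [← hst]
  have hle : MulAction.stabilizer (alternatingGroup (Fin n)) m ≤
      MulAction.stabilizer (alternatingGroup (Fin n)) (g : alternatingGroup (Fin n) ⧸ U) :=
    fun h hh => hx h hh
  refine (hle.eq_of_not_lt fun hlt => ?_).symm
  have := Subgroup.index_strictAnti hlt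
  rw [MulAction.index_stabilizer_of_transitive, MulAction.index_stabilizer_of_transitive] at this
  simp [hcard] at this

end ExceptSix

/-- For `n ≥ 5`, `n ≠ 6`, any two subgroups of index `n` in `Aₙ` are conjugate in `Aₙ`. -/
theorem statement4 (n : ℕ) (hn : 5 ≤ n) (hn6 : n ≠ 6)
    (U V : Subgroup (alternatingGroup (Fin n))) (hU : U.index = n) (hV : V.index = n) :
    ∃ g : alternatingGroup (Fin n), U.map (MulAut.conj g).toMonoidHom = V := by
  obtain ⟨g, hg⟩ := exists_map_conj_eq_stabilizer hn hn6 U hU ⟨0, by omega⟩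
  obtain ⟨h, hh⟩ := exists_map_conj_eq_stabilizer hn hn6 V hV ⟨0, by omega⟩
  refine ⟨h⁻¹ * g, ?_⟩
  have h1 : (V.map (MulAut.conj h).toMonoidHom).map (MulAut.conj h⁻¹).toMonoidHom = V := by
    rw [Subgroup.map_map]
    convert V.map_id
    ext
    simp
  rw [← h1, hh, ← hg, Subgroup.map_map]
  congr 1
end

section
/- Let n ≥ 5 with n ≠ 6. Then the alternating group A_n has exactly n subgroups of index n (namely the n point stabilizers). -/
open Equiv Equiv.Perm MulAction Subgroup
open scoped Nat Pointwise

section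

variable {α : Type*} [Fintype α] [DecidableEq α]

/-- A transitive permutation group generated by 3-cycles contains the alternating group. -/
theorem alternatingGroup_le_closure_of_isPretransitive {T : Set (Perm α)}
    (hT : ∀ g ∈ T, IsThreeCycle g) [IsPretransitive (closure T) α] :
    alternatingGroup α ≤ closure T := by
  rcases subsingleton_or_nontrivial α with _ | _
  · intro g _
    rw [Subsingleton.elim g 1]
    exact one_mem _
  obtain ⟨g₀, hg₀⟩ : T.Nonempty := by
    by_contra! h
    obtain ⟨a, b, hab⟩ := exists_pair_ne α
    obtain ⟨⟨g, hg⟩, h'⟩ := exists_smul_eq (closure T) a b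
    rw [h, Subgroup.closure_empty, mem_bot] at hg
    subst hg
    exact hab h'
  refine alternatingGroup_le_of_isPreprimitive_of_isThreeCycle_mem ⟨fun {B} hB ↦ ?_⟩
    (hT g₀ hg₀) (subset_closure hg₀)
  rw [IsTrivialBlock, or_iff_not_imp_left, Set.not_subsingleton_iff]
  rintro ⟨a, ha, b, hb, hab⟩
  have hfix : ∀ g ∈ T, g ∈ stabilizer (Perm α) B := by
    intro g hg
    by_contra hne
    have hdisj : Disjoint (g • B) B := by
      simpa using hB (g₁ := ⟨g, subset_closure hg⟩) (g₂ := 1) (by simpa using hne)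
    have hout : ∀ x ∈ B, ∀ y ∈ B, g x ≠ y := by
      rintro x hx y hy rfl
      exact Set.disjoint_left.1 hdisj ⟨x, hx, rfl⟩ hy
    have hcard := (hT g hg).card_support
    have hsub : ({a, b, g a, g b} : Finset α) ⊆ g.support := by
      intro x hx
      simp only [Finset.mem_insert, Finset.mem_singleton] at hx
      rcases hx with rfl | rfl | rfl | rfl <;> simp [hout _ ha _ ha, hout _ hb _ hb]
    have := Finset.card_le_card hsub
    rw [hcard, Finset.card_insert_of_notMem, Finset.card_insert_of_notMem,
      Finset.card_insert_of_notMem, Finset.card_singleton] at this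
    · omega
    · simpa using hab
    · simp [(hout _ ha _ hb).symm, (hout _ hb _ hb).symm]
    · simp [hab, (hout _ ha _ ha).symm, (hout _ hb _ ha).symm]
  have hle : closure T ≤ stabilizer (Perm α) B := (closure_le _).2 hfix
  refine Set.eq_univ_of_forall fun x ↦ ?_
  obtain ⟨⟨g, hg⟩, rfl⟩ := exists_smul_eq (closure T) a x
  have : g • B = B := hle hg
  rw [← this]
  exact Set.smul_mem_smul_set ha

/-- Point stabilizers in the alternating group are generated by their 3-cycles. -/
theorem closure_isThreeCycle_inter_stabilizer (p : α) :
    closure {g : alternatingGroup α | IsThreeCycle (g : Perm α) ∧ g • p = p} =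
      stabilizer (alternatingGroup α) p := by
  refine le_antisymm ((closure_le _).2 fun g hg ↦ hg.2) fun g hg ↦ ?_
  have hsupp : (g : Perm α).support ⊆ {p}ᶜ := by
    intro x hx
    simp only [Finset.mem_compl, Finset.mem_singleton]
    rintro rfl
    exact (mem_support.1 hx) hg
  rw [← alternatingGroup.mem_range_ofSubtype_iff, MonoidHom.range_eq_map,
    ← alternatingGroup.closure_isThreeCycles_eq_top, MonoidHom.map_closure] at hsupp
  refine closure_mono ?_ hsupp
  rintro _ ⟨k, hk, rfl⟩
  refine ⟨?_, ?_⟩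
  · rw [alternatingGroup.coe_ofSubtype, IsThreeCycle, cycleType_ofSubtype]
    exact hk
  · rw [Subgroup.smul_def, alternatingGroup.coe_ofSubtype, Perm.smul_def]
    exact Perm.ofSubtype_apply_of_not_mem _ (by simp)

theorem card_centralizer_alternatingGroup_le (g : alternatingGroup α) :
    Nat.card (centralizer {g}) ≤ Nat.card (centralizer {(g : Perm α)}) := by
  refine Nat.card_le_card_of_injective
    (fun x : centralizer {g} ↦ (⟨(x.1 : Perm α), mem_centralizer_singleton_iff.2
      (congrArg Subtype.val (mem_centralizer_singleton_iff.1 x.2))⟩ :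
        centralizer {(g : Perm α)})) fun x y h ↦ ?_
  have h1 : (x.1 : Perm α) = y.1 := Subtype.mk.inj h
  exact Subtype.ext (Subtype.ext h1)

theorem card_centralizer_le_two_mul_card_centralizer_alternatingGroup (g : alternatingGroup α) :
    Nat.card (centralizer {(g : Perm α)}) ≤ 2 * Nat.card (centralizer {g}) := by
  have h1 : (centralizer {g}).map (alternatingGroup α).subtype =
      alternatingGroup α ⊓ centralizer {(g : Perm α)} := by
    ext x
    simp only [mem_map, mem_inf, mem_centralizer_singleton_iff]
    constructor
    · rintro ⟨y, hy, rfl⟩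
      exact ⟨y.2, congrArg Subtype.val hy⟩
    · rintro ⟨hx, h⟩
      exact ⟨⟨x, hx⟩, Subtype.ext h, rfl⟩
  have h2 := card_map_of_injective (K := centralizer {g}) (alternatingGroup α).subtype_injective
  rw [h1] at h2
  have h3 : (alternatingGroup α).relIndex (centralizer {(g : Perm α)}) ≤ 2 := by
    refine Nat.le_of_dvd two_pos ((relIndex_dvd_index_of_normal _ _).trans ?_)
    rcases subsingleton_or_nontrivial α with _ | _
    · rw [alternatingGroup.index_eq_one]; exact one_dvd _
    · rw [alternatingGroup.index_eq_two]
  have h4 := relIndex_mul_relIndex ⊥ (alternatingGroup α ⊓ centralizer {(g : Perm α)})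
    (centralizer {(g : Perm α)}) bot_le inf_le_right
  rw [relIndex_bot_left, relIndex_bot_left, inf_relIndex_right, h2] at h4
  rw [← h4, mul_comm]
  exact Nat.mul_le_mul_right _ h3

theorem two_mul_three_pow_mul_factorial_lt (k : ℕ) :
    2 * 3 ^ (k + 2) * (k + 3)! < (3 * k + 6)! := by
  induction k with
  | zero => decide
  | succ k ih =>
    have h1 : (3 * (k + 1) + 6)! =
        (3 * k + 9) * ((3 * k + 8) * ((3 * k + 7) * (3 * k + 6)!)) := by
      rw [show 3 * (k + 1) + 6 = (3 * k + 6) + 1 + 1 + 1 by ring, Nat.factorial_succ,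
        Nat.factorial_succ, Nat.factorial_succ]
    have h2 : (k + 1 + 3)! = (k + 4) * (k + 3)! := Nat.factorial_succ (k + 3)
    calc 2 * 3 ^ (k + 1 + 2) * (k + 1 + 3)! = 3 * (k + 4) * (2 * 3 ^ (k + 2) * (k + 3)!) := by
          rw [h2]; ring
      _ < 3 * (k + 4) * (3 * k + 6)! := by gcongr
      _ ≤ ((3 * k + 9) * ((3 * k + 8) * (3 * k + 7))) * (3 * k + 6)! := by
        gcongr ?_ * _
        gcongr
        · omega
        · nlinarith
      _ = (3 * (k + 1) + 6)! := by rw [h1]; ring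

/-- Apart from degree six, a product of at least two disjoint 3-cycles
has a much smaller centralizer than a 3-cycle. -/
theorem two_mul_factorial_mul_three_pow_lt {m k : ℕ} (h : m + 3 * (k + 2) ≠ 6) :
    2 * (m ! * 3 ^ (k + 2) * (k + 2)!) < (m + 3 * (k + 1))! * 3 := by
  rcases k with _ | k
  · obtain ⟨m, rfl⟩ : ∃ l, m = l + 1 := ⟨m - 1, by omega⟩
    have : (m + 1 + 3 * (0 + 1))! = (m + 4) * ((m + 3) * ((m + 2) * (m + 1)!)) := by
      rw [show m + 1 + 3 * (0 + 1) = (m + 1) + 1 + 1 + 1 by ring, Nat.factorial_succ,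
        Nat.factorial_succ, Nat.factorial_succ]
    rw [this]
    calc _ = 36 * (m + 1)! := by norm_num [Nat.factorial]; ring
      _ < ((m + 4) * (m + 3) * (m + 2) * 3) * (m + 1)! := by
        gcongr
        nlinarith [Nat.zero_le (m ^ 2), Nat.zero_le (m ^ 3)]
      _ = _ := by ring
  · calc _ = 3 * m ! * (2 * 3 ^ (k + 2) * (k + 3)!) := by ring
      _ < 3 * m ! * (3 * k + 6)! := by
        have := Nat.factorial_pos m
        gcongr
        exact two_mul_three_pow_mul_factorial_lt k
      _ = 3 * (m ! * (3 * k + 6)!) := by ring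
      _ ≤ 3 * (m + (3 * k + 6))! := by
        gcongr
        exact Nat.le_of_dvd (Nat.factorial_pos _) (Nat.factorial_mul_factorial_dvd_factorial_add _ _)
      _ = _ := by rw [mul_comm, show m + (3 * k + 6) = m + 3 * (k + 1 + 1) by ring]

/-- Automorphisms of the alternating group preserve 3-cycles, except in degree six. -/
theorem isThreeCycle_mulEquiv_alternatingGroup (h6 : Fintype.card α ≠ 6)
    (ψ : alternatingGroup α ≃* alternatingGroup α) {g : alternatingGroup α}
    (hg : IsThreeCycle (g : Perm α)) : IsThreeCycle (ψ g : Perm α) := by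
  have hord : orderOf (ψ g : Perm α) = 3 := by
    rw [orderOf_coe, MulEquiv.orderOf_eq, ← orderOf_coe, hg.orderOf]
  obtain ⟨k, hk⟩ := cycleType_prime_order (σ := (ψ g : Perm α)) (hord ▸ Nat.prime_three)
  rw [hord] at hk
  rcases k with _ | k
  · simpa [IsThreeCycle] using hk
  exfalso
  have hcentr : Nat.card (centralizer {g}) = Nat.card (centralizer {ψ g}) := by
    refine Nat.card_congr (ψ.toEquiv.subtypeEquiv fun x ↦ ?_)
    rw [mem_centralizer_singleton_iff, mem_centralizer_singleton_iff]
    change _ ↔ ψ x * ψ g = ψ g * ψ x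
    rw [← map_mul, ← map_mul, ψ.injective.eq_iff]
  have h1 := card_centralizer_le_two_mul_card_centralizer_alternatingGroup g
  have h2 := card_centralizer_alternatingGroup_le (ψ g)
  have hle : (ψ g : Perm α).cycleType.sum ≤ Fintype.card α := by
    rw [sum_cycleType]
    exact Finset.card_le_univ _
  rw [nat_card_centralizer, hg.cycleType] at h1
  rw [nat_card_centralizer, hk] at h2
  rw [hk] at hle
  simp only [Multiset.sum_replicate, smul_eq_mul] at hle
  obtain ⟨m, hm⟩ := Nat.exists_eq_add_of_le' hle
  have hm' : Fintype.card α - 3 = m + 3 * (k + 1) := by omega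
  have hm'' : Fintype.card α - (k + 1 + 1) * 3 = m := by omega
  have := two_mul_factorial_mul_three_pow_lt (m := m) (k := k) (by omega)
  rw [Multiset.sum_singleton, hm', Multiset.prod_singleton, Multiset.toFinset_singleton,
    Finset.prod_singleton, Multiset.count_singleton_self, Nat.factorial_one, mul_one] at h1
  rw [show k + 1 + 1 = k + 2 from rfl] at h2 hm''
  rw [Multiset.sum_replicate, smul_eq_mul, hm'', Multiset.prod_replicate,
    Multiset.toFinset_replicate, if_neg (by omega), Finset.prod_singleton,
    Multiset.count_replicate_self] at h2
  omega

theorem le_choose_of_pos_of_lt {n k : ℕ} (hk : 0 < k) (hkn : k < n) : n ≤ n.choose k := by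
  induction n generalizing k with
  | zero => omega
  | succ n ih =>
    obtain ⟨k, rfl⟩ : ∃ l, k = l + 1 := ⟨k - 1, by omega⟩
    rw [Nat.choose_succ_succ']
    have h0 : 0 < n.choose k := Nat.choose_pos (by omega)
    rcases (show k + 1 = n ∨ k + 1 < n by omega) with h | h
    · subst h
      simp
    · have : n ≤ n.choose (k + 1) := ih (Nat.succ_pos k) h
      omega

theorem eq_one_or_of_choose_le {n k : ℕ} (hk : 0 < k) (hkn : k < n) (h : n.choose k ≤ n) :
    k = 1 ∨ k + 1 = n := by
  by_contra! hne
  obtain ⟨n, rfl⟩ : ∃ l, n = l + 1 := ⟨n - 1, by omega⟩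
  obtain ⟨k, rfl⟩ : ∃ l, k = l + 1 := ⟨k - 1, by omega⟩
  rw [Nat.choose_succ_succ'] at h
  have h1 := le_choose_of_pos_of_lt (n := n) (k := k) (by omega) (by omega)
  have h2 := le_choose_of_pos_of_lt (n := n) (k := k + 1) (by omega) (by omega)
  omega

theorem index_stabilizer_alternatingGroup (h5 : 5 ≤ Fintype.card α) (p : α) :
    (stabilizer (alternatingGroup α) p).index = Fintype.card α := by
  have := alternatingGroup.isPretransitive_of_three_le_card α
    (by rw [Nat.card_eq_fintype_card]; omega)
  rw [index_stabilizer_of_transitive, Nat.card_eq_fintype_card]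

/-- An intransitive subgroup of the alternating group of index the degree is a point stabilizer. -/
theorem exists_eq_stabilizer_of_not_isPretransitive (h5 : 5 ≤ Fintype.card α)
    {U : Subgroup (alternatingGroup α)} (hU : U.index = Fintype.card α)
    (hUt : ¬ IsPretransitive U α) : ∃ q : α, U = stabilizer (alternatingGroup α) q := by
  suffices ∃ q : α, U ≤ stabilizer (alternatingGroup α) q by
    obtain ⟨q, hq⟩ := this
    refine ⟨q, eq_of_le_of_card_ge hq ?_⟩
    have h1 := U.card_mul_index
    have h2 := (stabilizer (alternatingGroup α) q).card_mul_index
    rw [index_stabilizer_alternatingGroup h5, ← h1, hU] at h2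
    exact (Nat.eq_of_mul_eq_mul_right (by omega) h2).le
  obtain ⟨a, b, hab⟩ : ∃ a b : α, b ∉ orbit U a := by
    by_contra! h
    exact hUt ⟨fun a b ↦ h a b⟩
  classical
  set S : Finset α := (orbit U a).toFinset with hS
  have haS : a ∈ S := by simp [hS]
  have hbS : b ∉ S := by simpa [hS] using hab
  have hUS : ∀ u ∈ U, ∀ x, u • x ∈ S ↔ x ∈ S := by
    intro u hu x
    have : (⟨u, hu⟩ : U) • x ∈ orbit U a ↔ x ∈ orbit U a := by
      rw [← orbit_eq_iff, orbit_smul, orbit_eq_iff]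
    simpa [hS] using this
  let s : Set.powersetCard α S.card := ⟨S, rfl⟩
  have hle : U ≤ stabilizer (alternatingGroup α) s := by
    intro u hu
    refine Subtype.ext ?_
    change u • S = S
    refine Finset.eq_of_subset_of_card_le (fun x hx ↦ ?_) (by simp)
    obtain ⟨y, hy, rfl⟩ := Finset.mem_smul_finset.1 hx
    exact (hUS u hu y).2 hy
  have h3 : 3 ≤ Nat.card α := by rw [Nat.card_eq_fintype_card]; omega
  have := Set.powersetCard.isPretransitive_alternatingGroup (n := S.card) h3
  have hchoose : (Fintype.card α).choose S.card ≤ Fintype.card α := by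
    refine Nat.le_of_dvd (by omega) ?_
    have := index_dvd_of_le hle
    rwa [index_stabilizer_of_transitive, hU, Set.powersetCard.card,
      Nat.card_eq_fintype_card] at this
  rcases eq_one_or_of_choose_le (Finset.card_pos.2 ⟨a, haS⟩)
    (Finset.card_lt_univ_of_notMem hbS) hchoose with h | h
  · obtain ⟨q, hq⟩ := Finset.card_eq_one.1 h
    refine ⟨q, fun u hu ↦ ?_⟩
    simpa [hq] using hUS u hu q
  · obtain ⟨q, hq⟩ := Finset.card_eq_one.1 (show Sᶜ.card = 1 by rw [Finset.card_compl]; omega)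
    have hmem : ∀ x, x ∉ S ↔ x = q := by simp [← Finset.mem_compl, hq]
    exact ⟨q, fun u hu ↦ (hmem _).1 ((hUS u hu q).not.2 ((hmem q).2 rfl))⟩

/-- Automorphisms of the alternating group permute the point stabilizers,
except in degree six. -/
theorem exists_map_stabilizer_eq_stabilizer (h5 : 5 ≤ Fintype.card α) (h6 : Fintype.card α ≠ 6)
    (ψ : alternatingGroup α ≃* alternatingGroup α) (p : α) :
    ∃ q : α, (stabilizer (alternatingGroup α) p).map (ψ : alternatingGroup α →* alternatingGroup α)
      = stabilizer (alternatingGroup α) q := by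
  have hindex : ((stabilizer (alternatingGroup α) p).map
      (ψ : alternatingGroup α →* alternatingGroup α)).index = Fintype.card α := by
    rw [index_map_equiv, index_stabilizer_alternatingGroup h5]
  refine exists_eq_stabilizer_of_not_isPretransitive h5 hindex fun htrans ↦ ?_
  set U := (stabilizer (alternatingGroup α) p).map (ψ : alternatingGroup α →* alternatingGroup α)
    with hU
  obtain ⟨T, hT, hTU⟩ : ∃ T : Set (Perm α), (∀ g ∈ T, IsThreeCycle g) ∧
      U.map (alternatingGroup α).subtype = closure T := by
    rw [hU, ← closure_isThreeCycle_inter_stabilizer, MonoidHom.map_closure, MonoidHom.map_closure]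
    refine ⟨_, ?_, rfl⟩
    rintro _ ⟨_, ⟨g, hg, rfl⟩, rfl⟩
    exact isThreeCycle_mulEquiv_alternatingGroup h6 ψ hg.1
  have : IsPretransitive (closure T) α := by
    refine ⟨fun x y ↦ ?_⟩
    obtain ⟨⟨u, hu⟩, h⟩ := htrans.exists_smul_eq x y
    exact ⟨⟨u, hTU ▸ mem_map_of_mem _ hu⟩, h⟩
  have hle := alternatingGroup_le_closure_of_isPretransitive hT
  have htop : U = ⊤ := by
    refine (eq_top_iff' _).2 fun x ↦ ?_
    obtain ⟨y, hy, hyx⟩ := hTU ▸ hle x.2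
    rwa [← Subtype.ext (a1 := y) (a2 := x) hyx]
  rw [htop, index_top] at hindex
  omega

/-- Every subgroup of the alternating group whose index is the degree is the image of a
point stabilizer under an automorphism. -/
theorem exists_mulEquiv_map_stabilizer_eq (h5 : 5 ≤ Fintype.card α)
    {U : Subgroup (alternatingGroup α)} (hU : U.index = Fintype.card α) :
    ∃ (ψ : alternatingGroup α ≃* alternatingGroup α) (p : α),
      (stabilizer (alternatingGroup α) p).map (ψ : alternatingGroup α →* alternatingGroup α)
        = U := by
  have : Nontrivial α := Fintype.one_lt_card_iff_nontrivial.1 (by omega)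
  have : IsSimpleGroup (alternatingGroup α) :=
    alternatingGroup.isSimpleGroup (by rwa [Nat.card_eq_fintype_card])
  let e : (alternatingGroup α ⧸ U) ≃ α :=
    (Finite.equivFinOfCardEq hU).trans (Fintype.equivFin α).symm
  let f : alternatingGroup α →* Perm α :=
    e.permCongrHom.toMonoidHom.comp (toPermHom (alternatingGroup α) (alternatingGroup α ⧸ U))
  have hf (g : alternatingGroup α) (x : alternatingGroup α ⧸ U) : f g (e x) = e (g • x) := by
    simp [f]
  have hmem (g : alternatingGroup α) :
      f g (e (1 : alternatingGroup α)) = e (1 : alternatingGroup α) ↔ g ∈ U := by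
    rw [hf, e.injective.eq_iff]
    change ((g * 1 : alternatingGroup α) : alternatingGroup α ⧸ U) = _ ↔ _
    rw [eq_comm, QuotientGroup.eq]
    simp
  have hinj : Function.Injective f := by
    rw [← MonoidHom.ker_eq_bot_iff]
    refine (IsSimpleGroup.eq_bot_or_eq_top_of_normal f.ker inferInstance).resolve_right fun h ↦ ?_
    have : U = ⊤ := by
      refine (eq_top_iff' _).2 fun x ↦ (hmem x).1 ?_
      rw [(MonoidHom.mem_ker).1 (h ▸ mem_top x)]
      rfl
    rw [this, index_top] at hU
    omega
  have hrange : f.range = alternatingGroup α := by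
    apply eq_alternatingGroup_of_index_eq_two
    have h1 := f.range.card_mul_index
    have h2 : Nat.card f.range = Nat.card (alternatingGroup α) :=
      (Nat.card_congr (MonoidHom.ofInjective hinj).toEquiv).symm
    rw [h2, ← two_mul_nat_card_alternatingGroup, mul_comm 2] at h1
    exact Nat.eq_of_mul_eq_mul_left Nat.card_pos h1
  let ψ : alternatingGroup α ≃* alternatingGroup α :=
    (MonoidHom.ofInjective hinj).trans (MulEquiv.subgroupCongr hrange)
  refine ⟨ψ.symm, e (1 : alternatingGroup α), ?_⟩
  ext g
  rw [← hmem g]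
  exact mem_map_equiv

theorem stabilizer_alternatingGroup_injective (h5 : 5 ≤ Fintype.card α) :
    Function.Injective (fun p : α ↦ stabilizer (alternatingGroup α) p) := by
  intro p q h
  by_contra hpq
  obtain ⟨r, hr⟩ := Finset.exists_mem_notMem_of_card_lt_card
    (s := {p, q}) (t := Finset.univ) (Finset.card_le_two.trans_lt (by rw [Finset.card_univ]; omega))
  obtain ⟨s, hs⟩ := Finset.exists_mem_notMem_of_card_lt_card
    (s := {p, q, r}) (t := Finset.univ)
    (Finset.card_le_three.trans_lt (by rw [Finset.card_univ]; omega))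
  simp only [Finset.mem_univ, Finset.mem_insert, Finset.mem_singleton, not_or, true_and] at hr hs
  have h3 := isThreeCycle_swap_mul_swap_same (a := q) (b := r) (c := s) (Ne.symm hr.2)
    (Ne.symm hs.2.1) (Ne.symm hs.2.2)
  have hp : (⟨_, h3.mem_alternatingGroup⟩ : alternatingGroup α) ∈
      stabilizer (alternatingGroup α) p := by
    change (swap q r * swap q s) p = p
    rw [Perm.mul_apply, swap_apply_of_ne_of_ne hpq (Ne.symm hs.1),
      swap_apply_of_ne_of_ne hpq (Ne.symm hr.1)]
  simp only at h
  rw [h] at hp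
  change (swap q r * swap q s) q = q at hp
  rw [Perm.mul_apply, swap_apply_left, swap_apply_of_ne_of_ne hs.2.1 hs.2.2] at hp
  exact hs.2.1 hp

end

/-- For `n ≥ 5`, `n ≠ 6`, the alternating group `Aₙ` has exactly `n` subgroups of index `n`. -/
theorem statement5 (n : ℕ) (hn : 5 ≤ n) (hn6 : n ≠ 6) :
    {U : Subgroup (alternatingGroup (Fin n)) | U.index = n}.ncard = n := by
  have h5 : 5 ≤ Fintype.card (Fin n) := by simpa
  have h6 : Fintype.card (Fin n) ≠ 6 := by simpa
  have hset : {U : Subgroup (alternatingGroup (Fin n)) | U.index = n} =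
      Set.range (fun p : Fin n ↦ stabilizer (alternatingGroup (Fin n)) p) := by
    ext U
    constructor
    · intro hU
      obtain ⟨ψ, p, rfl⟩ := exists_mulEquiv_map_stabilizer_eq h5 (hU.trans (Fintype.card_fin n).symm)
      obtain ⟨q, hq⟩ := exists_map_stabilizer_eq_stabilizer h5 h6 ψ p
      exact ⟨q, hq.symm⟩
    · rintro ⟨p, rfl⟩
      exact (index_stabilizer_alternatingGroup h5 p).trans (Fintype.card_fin n)
  rw [hset, ← Set.image_univ, Set.ncard_image_of_injective _
    (stabilizer_alternatingGroup_injective h5), Set.ncard_univ, Nat.card_eq_fintype_card,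
    Fintype.card_fin]
end

section
/- Let p be a prime with p ≡ ±1 (mod 8) and let G = PGL(2,p). Then for every maximal subgroup M of G, every c-section of M is supersolvable. Consequently, since G is not solvable, G is a counterexample to the question whether supersolvability of all c-sections of maximal subgroups forces solvability. -/
/-- A finite group is *supersolvable* if it has a chain of subgroups
`1 = G₀ ≤ G₁ ≤ ... ≤ Gₙ = G`, each normal in `G`, with successive quotients cyclic. -/
def IsSupersolvable (G : Type*) [Group G] : Prop :=
  ∃ (n : ℕ) (f : Fin (n + 1) → Subgroup G),
    Monotone f ∧ f 0 = ⊥ ∧ f (Fin.last n) = ⊤ ∧ (∀ i, (f i).Normal) ∧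
      ∀ i : Fin n, ∃ x ∈ f i.succ, f i.succ ≤ f i.castSucc ⊔ Subgroup.zpowers x

/-- `PGL(n, p)`: the projective general linear group of degree `n` over `ZMod p`. -/
abbrev PGL (n p : ℕ) : Type :=
  GL (Fin n) (ZMod p) ⧸ Subgroup.center (GL (Fin n) (ZMod p))

lemma polyhedral_numerics (m a b c x y z : ℕ) (ha : a * x = m) (hb : b * y = m) (hc : c * z = m)
    (hx : 2 ≤ x) (hxy : x ≤ y) (hyz : y ≤ z) (a3 : 3 ≤ c) (hs : a + b + c = m + 2) :
    m = 12 ∧ z ≤ 3 ∨ (m = 24 ∨ m = 60) ∧ z ≤ 5 := by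
  have hx2 : x = 2 := by
    by_contra h
    have : 3 ≤ x := by omega
    nlinarith
  subst hx2
  have hy4 : y < 4 := by
    by_contra h
    nlinarith
  interval_cases y
  · omega
  · have : z < 6 := by
      by_contra h
      nlinarith
    interval_cases z <;> omega

open MulAction in
/-- The points with non-trivial stabilizer. -/
def singularPoints (Γ Y : Type*) [Group Γ] [MulAction Γ Y] : SubMulAction Γ Y where
  carrier := {y | stabilizer Γ y ≠ ⊥}
  smul_mem' g y hy := by
    change stabilizer Γ (g • y) ≠ ⊥
    rw [stabilizer_smul_eq_stabilizer_map_conj, Ne,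
      Subgroup.map_eq_bot_iff_of_injective _ (MulAut.conj g).injective]
    exact hy

section
open MulAction

variable {Γ Y : Type*} [Group Γ] [MulAction Γ Y]

lemma finite_singularPoints [Finite Γ] (h : ∀ g : Γ, g ≠ 1 → (fixedBy Y g).ncard = 2) :
    Finite (singularPoints Γ Y) := by
  have : (⋃ g : {g : Γ // g ≠ 1}, fixedBy Y (g : Γ)).Finite :=
    Set.finite_iUnion fun g ↦ Set.finite_of_ncard_ne_zero (by rw [h g g.2]; simp)
  refine (this.subset fun y hy ↦ ?_).to_subtype
  obtain ⟨g, hg⟩ := Subgroup.ne_bot_iff_exists_ne_one.1 hy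
  exact Set.mem_iUnion.2 ⟨⟨g, fun h ↦ hg (Subtype.ext h)⟩, g.2⟩

lemma card_fixedBy_singularPoints (h : ∀ g : Γ, g ≠ 1 → (fixedBy Y g).ncard = 2) {g : Γ}
    (hg : g ≠ 1) : Nat.card (fixedBy (singularPoints Γ Y) g) = 2 := by
  rw [← h g hg, ← Nat.card_coe_set_eq]
  refine Nat.card_congr ⟨fun x ↦ ⟨x.1.1, congrArg Subtype.val x.2⟩, fun y ↦ ⟨⟨y.1, ?_⟩,
    Subtype.ext y.2⟩, fun _ ↦ rfl, fun _ ↦ rfl⟩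
  exact fun hb ↦ hg (by simpa [hb] using (show g ∈ stabilizer Γ y.1 from y.2))

/-- If every non-trivial element of a finite group has exactly two fixed points, then the group has
a point stabilizer of index at most `2` (as for cyclic and dihedral rotation groups), or its order
and its point stabilizers are bounded as for the rotation groups of the regular solids. -/
lemma exists_large_stabilizer_or [Finite Γ] (hY : Nonempty Y)
    (h : ∀ g : Γ, g ≠ 1 → (fixedBy Y g).ncard = 2) :
    (∃ y : Y, Nat.card Γ ≤ 2 * Nat.card (stabilizer Γ y)) ∨
    (Nat.card Γ = 12 ∧ ∀ y : Y, Nat.card (stabilizer Γ y) ≤ 3) ∨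
    ((Nat.card Γ = 24 ∨ Nat.card Γ = 60) ∧ ∀ y : Y, Nat.card (stabilizer Γ y) ≤ 5) := by
  classical
  set X := singularPoints Γ Y
  have : Finite X := finite_singularPoints h
  cases nonempty_fintype Γ
  cases nonempty_fintype X
  refine or_iff_not_imp_left.2 fun hno ↦ ?_
  push Not at hno
  set m := Nat.card Γ with hm
  let Ω := orbitRel.Quotient Γ X
  have : Finite Ω := Quotient.finite _
  cases nonempty_fintype Ω
  obtain ⟨y₀⟩ := hY
  have hm3 : 3 ≤ m := by
    have h1 := hno y₀
    have h2 : 0 < Nat.card (stabilizer Γ y₀) := Nat.card_pos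
    omega
  have burnside := sum_card_fixedBy_eq_card_orbits_mul_card_group Γ X
  rw [← Finset.add_sum_erase _ _ (Finset.mem_univ (1 : Γ)),
    Finset.sum_congr rfl (g := fun _ ↦ 2) (fun g hg ↦ by
      rw [← Nat.card_eq_fintype_card]
      exact card_fixedBy_singularPoints h (Finset.ne_of_mem_erase hg))] at burnside
  simp only [← Nat.card_eq_fintype_card, Finset.sum_const, Finset.card_erase_of_mem,
    Finset.mem_univ, Finset.card_univ] at burnside
  rw [← hm] at burnside
  have hX1 : Nat.card (fixedBy X (1 : Γ)) = Nat.card X := by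
    rw [fixedBy_one_eq_univ]; exact Nat.card_univ
  let n : Ω → ℕ := fun ω ↦ Nat.card ω.orbit
  let s : Ω → ℕ := fun ω ↦ Nat.card (stabilizer Γ ω.out)
  have hXn : Nat.card X = ∑ ω, n ω := by
    rw [Nat.card_congr (selfEquivSigmaOrbits' Γ X), Nat.card_sigma]
  have hns (ω : Ω) : n ω * s ω = m := by
    have := card_orbit_mul_card_stabilizer_eq_card_group Γ ω.out
    simp only [← Nat.card_eq_fintype_card] at this
    rw [← hm] at this
    simp only [n, s]
    rw [orbitRel.Quotient.orbit_eq_orbit_out ω Quotient.out_eq']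
    exact this
  have hstab (x : X) : stabilizer Γ x = stabilizer Γ (x : Y) := SubMulAction.stabilizer_of_subMul x
  have hs2 (ω : Ω) : 2 ≤ s ω := by
    have := (ω.out : X).2
    simp only [s, hstab]
    exact (Subgroup.one_lt_card_iff_ne_bot _).2 this
  have hn3 (ω : Ω) : 3 ≤ n ω := by
    have h1 := hno (ω.out : X)
    rw [← hstab, ← hns ω] at h1
    change _ * s ω < _ at h1
    exact lt_of_mul_lt_mul_right h1 (Nat.zero_le _)
  have hsx (y : Y) (k : ℕ) (hk : 1 ≤ k) (hsk : ∀ ω, s ω ≤ k) : Nat.card (stabilizer Γ y) ≤ k := by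
    by_cases hy : stabilizer Γ y = ⊥
    · simpa [hy] using hk
    · let x : X := ⟨y, hy⟩
      have h1 : Nat.card (stabilizer Γ x) = s (Quotient.mk'' x) := by
        refine Nat.card_congr (stabilizerEquivStabilizerOfOrbitRel ?_).toEquiv
        exact (orbitRel Γ X).symm (Quotient.exact (Quotient.out_eq' (Quotient.mk'' x : Ω)))
      rw [show stabilizer Γ y = stabilizer Γ x from (hstab x).symm, h1]
      exact hsk _
  rw [hX1, hXn] at burnside
  have hnm (ω : Ω) : 2 * n ω ≤ m := by
    rw [← hns ω, mul_comm]; exact Nat.mul_le_mul_left _ (hs2 ω)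
  have hr4 : Nat.card Ω < 4 := by
    have h1 : ∑ ω, 2 * n ω ≤ ∑ ω : Ω, m := Finset.sum_le_sum fun ω _ ↦ hnm ω
    rw [← Finset.mul_sum, Finset.sum_const, Finset.card_univ, ← Nat.card_eq_fintype_card,
      smul_eq_mul] at h1
    by_contra hc
    have : 4 * m ≤ Nat.card Ω * m := Nat.mul_le_mul_right _ (not_lt.1 hc)
    change _ = Nat.card Ω * m at burnside
    simp only [smul_eq_mul] at burnside
    omega
  change _ = Nat.card Ω * m at burnside
  obtain ⟨r, hr⟩ : ∃ r, Nat.card Ω = r := ⟨_, rfl⟩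
  have e : Fin r ≃ Ω := (Finite.equivFinOfCardEq hr).symm
  rw [hr] at hr4 burnside
  rw [← e.sum_comp] at burnside
  simp only [smul_eq_mul] at burnside
  interval_cases r
  · simp at burnside; omega
  · have := hnm (e 0)
    simp at burnside; omega
  · have := hn3 (e 0)
    have := hn3 (e 1)
    simp at burnside; omega
  · have key (i j k : Fin 3) (hijk : ∀ l, l = i ∨ l = j ∨ l = k)
        (hsum : n (e i) + n (e j) + n (e k) = m + 2)
        (hij : s (e i) ≤ s (e j)) (hjk : s (e j) ≤ s (e k)) :
        m = 12 ∧ (∀ y : Y, Nat.card (stabilizer Γ y) ≤ 3) ∨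
        (m = 24 ∨ m = 60) ∧ ∀ y : Y, Nat.card (stabilizer Γ y) ≤ 5 := by
      have hmax (ω : Ω) : s ω ≤ s (e k) := by
        obtain ⟨l, rfl⟩ := e.surjective ω
        rcases hijk l with rfl | rfl | rfl <;> omega
      refine (polyhedral_numerics m _ _ _ _ _ _ (hns (e i)) (hns (e j)) (hns (e k)) (hs2 _)
        hij hjk (hn3 _) hsum).imp (fun h ↦ ⟨h.1, fun y ↦ ?_⟩) (fun h ↦ ⟨h.1, fun y ↦ ?_⟩)
      · exact hsx y 3 (by simp) fun ω ↦ (hmax ω).trans h.2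
      · exact hsx y 5 (by simp) fun ω ↦ (hmax ω).trans h.2
    have hsum : n (e 0) + n (e 1) + n (e 2) = m + 2 := by
      rw [Fin.sum_univ_three] at burnside; omega
    rcases le_total (s (e 0)) (s (e 1)) with h01 | h01 <;>
    rcases le_total (s (e 1)) (s (e 2)) with h12 | h12 <;>
    rcases le_total (s (e 0)) (s (e 2)) with h02 | h02
    · exact key 0 1 2 (by decide) (by omega) (by omega) (by omega)
    · exact key 0 1 2 (by decide) (by omega) (by omega) (by omega)
    · exact key 0 2 1 (by decide) (by omega) (by omega) (by omega)
    · exact key 2 0 1 (by decide) (by omega) (by omega) (by omega)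
    · exact key 1 0 2 (by decide) (by omega) (by omega) (by omega)
    · exact key 1 2 0 (by decide) (by omega) (by omega) (by omega)
    · exact key 2 1 0 (by decide) (by omega) (by omega) (by omega)
    · exact key 2 1 0 (by decide) (by omega) (by omega) (by omega)

end

lemma IsSupersolvable.of_surjective {G H : Type*} [Group G] [Group H] (h : IsSupersolvable G)
    (φ : G →* H) (hφ : Function.Surjective φ) : IsSupersolvable H := by
  obtain ⟨n, f, hmono, h0, h1, hn, hc⟩ := h
  refine ⟨n, fun i ↦ (f i).map φ, fun i j hij ↦ Subgroup.map_mono (hmono hij), by simp [h0], ?_,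
    fun i ↦ (hn i).map φ hφ, fun i ↦ ?_⟩
  · simp only [h1]
    exact Subgroup.map_top_of_surjective φ hφ
  · obtain ⟨x, hx, hle⟩ := hc i
    refine ⟨φ x, Subgroup.mem_map_of_mem φ hx, ?_⟩
    have := Subgroup.map_mono (f := φ) hle
    rwa [Subgroup.map_sup, MonoidHom.map_zpowers] at this

lemma isSupersolvable_of_subsingleton {G : Type*} [Group G] [Subsingleton G] :
    IsSupersolvable G :=
  ⟨0, fun _ ↦ ⊥, monotone_const, rfl, Subsingleton.elim _ _, fun _ ↦ inferInstance,
    fun i ↦ i.elim0⟩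

lemma isSupersolvable_of_character {H K : Type*} [Group H] [Finite H] [Field K] (p : ℕ)
    [hp : Fact p.Prime] [CharP K p] (hH : ¬ p ^ 2 ∣ Nat.card H) (C : Subgroup H)
    (hC : Nat.card H ≤ 2 * Nat.card C) (χ : C →* Kˣ) (hχ : ∀ c, χ c = 1 → c ^ p = 1) :
    IsSupersolvable H := by
  have hχ' (c : C) (hc : c ^ p = 1) : χ c = 1 := by
    have h1 : (χ c : K) ^ p = 1 := by rw [← Units.val_pow_eq_pow_val, ← map_pow, hc]; simp
    have h2 : ((χ c : K) - 1) ^ p = 0 := by rw [sub_pow_char, h1]; simp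
    exact Units.ext (sub_eq_zero.1 (pow_eq_zero_iff hp.out.ne_zero |>.1 h2))
  have hidx : C.index = 1 ∨ C.index = 2 := by
    have h1 := C.index_mul_card
    have h2 : 0 < Nat.card C := Nat.card_pos
    have h3 : C.index ≠ 0 := Subgroup.index_ne_zero_of_finite
    have h4 : C.index ≤ 2 := by
      rw [← h1] at hC
      exact le_of_mul_le_mul_right hC h2
    omega
  have hCn : C.Normal := by
    rcases hidx with h | h
    · rw [Subgroup.index_eq_one.1 h]; infer_instance
    · exact Subgroup.normal_of_index_eq_two h
  set N : Subgroup H := χ.ker.map C.subtype with hN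
  have hmem (g : H) : g ∈ N ↔ g ∈ C ∧ g ^ p = 1 := by
    constructor
    · rintro ⟨c, hc, rfl⟩
      exact ⟨c.2, by simpa using congrArg Subtype.val (hχ c hc)⟩
    · rintro ⟨hg, hgp⟩
      exact ⟨⟨g, hg⟩, hχ' _ (Subtype.ext hgp), rfl⟩
  have hNn : N.Normal := ⟨fun n hn g ↦ by
    rw [hmem] at hn ⊢
    exact ⟨hCn.conj_mem n hn.1 g, by rw [conj_pow, hn.2]; simp⟩⟩
  have hNc : IsCyclic N := by
    have hpg : IsPGroup p N := fun g ↦ ⟨1, Subtype.ext (by simpa using ((hmem g).1 g.2).2)⟩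
    obtain ⟨k, hk⟩ := hpg.exists_card_eq
    have hk2 : k < 2 := by
      by_contra h
      exact hH (((pow_dvd_pow p (not_lt.1 h)).trans hk.symm.dvd).trans N.card_subgroup_dvd_card)
    interval_cases k
    · have := (Nat.card_eq_one_iff_unique.1 hk).1
      infer_instance
    · exact isCyclic_of_prime_card (p := p) (by simpa using hk)
  obtain ⟨⟨a, ha⟩, haN⟩ := hNc
  have : Finite χ.range := Finite.of_surjective _ χ.rangeRestrict_surjective
  have hrc : IsCyclic χ.range := isCyclic_subgroup_units _
  obtain ⟨⟨_, b, rfl⟩, hb⟩ := hrc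
  obtain ⟨d, hd⟩ : ∃ d : H, ∀ g, g ∈ C ∨ g * d⁻¹ ∈ C := by
    rcases hidx with h | h
    · exact ⟨1, fun g ↦ by simp [Subgroup.index_eq_one.1 h]⟩
    · obtain ⟨d, hd⟩ := Subgroup.index_eq_two_iff.1 h
      exact ⟨d⁻¹, fun g ↦ by rcases hd g with h | h <;> simp [h.1]⟩
  refine ⟨3, ![⊥, N, C, ⊤], ?_, rfl, rfl, ?_, ?_⟩
  · rw [Fin.monotone_iff_le_succ]
    intro i
    fin_cases i
    · exact bot_le
    · exact fun g hg ↦ ((hmem g).1 hg).1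
    · exact le_top
  · intro i
    fin_cases i
    · exact (inferInstance : (⊥ : Subgroup H).Normal)
    · exact hNn
    · exact hCn
    · exact (inferInstance : (⊤ : Subgroup H).Normal)
  · intro i
    fin_cases i
    · refine ⟨a, ha, fun g hg ↦ Subgroup.mem_sup_right ?_⟩
      obtain ⟨k, hk⟩ := haN ⟨g, hg⟩
      exact ⟨k, by simpa using congrArg Subtype.val hk⟩
    · refine ⟨b, b.2, fun g hg ↦ ?_⟩
      obtain ⟨k, hk⟩ := hb ⟨χ ⟨g, hg⟩, _, rfl⟩
      have hk' : χ b ^ k = χ ⟨g, hg⟩ := by simpa using congrArg Subtype.val hk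
      have h1 : (g * ((b : H) ^ k)⁻¹) ∈ N :=
        ⟨⟨g, hg⟩ * (b ^ k)⁻¹, by simp [MonoidHom.mem_ker, hk'], by simp⟩
      rw [show g = (g * ((b : H) ^ k)⁻¹) * (b : H) ^ k by group]
      exact Subgroup.mul_mem_sup h1 ⟨k, rfl⟩
    · refine ⟨d, trivial, fun g _ ↦ ?_⟩
      rcases hd g with h | h
      · exact Subgroup.mem_sup_left h
      · rw [show g = (g * d⁻¹) * d by group]
        exact Subgroup.mul_mem_sup h (Subgroup.mem_zpowers d)

lemma normal_of_index_three_of_card_eq_twelve {H : Type*} [Group H] (hH : Nat.card H = 12)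
    (ho : ∀ g : H, orderOf g ≤ 3) (V : Subgroup H) (hV : V.index = 3) : V.Normal := by
  have : Finite H := Nat.finite_of_card_ne_zero (by simp [hH])
  have hV4 : Nat.card V = 4 := by
    have := V.index_mul_card
    rw [hH, hV] at this
    omega
  by_contra hn
  have hdvd : V.normalCore.index ∣ 6 := by
    have h : V.normalCore.index ∣ (V.index).factorial := by
      rw [Subgroup.normalCore_eq_ker, Subgroup.index_ker, Subgroup.index_eq_card, ← Nat.card_perm]
      exact Subgroup.card_subgroup_dvd_card _
    rwa [hV] at h
  have hc4 : Nat.card V.normalCore ∣ 4 := hV4 ▸ Subgroup.card_dvd_of_le V.normalCore_le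
  have hcne : Nat.card V.normalCore ≠ 4 := fun h ↦ by
    have h1 := Subgroup.eq_of_le_of_card_ge V.normalCore_le (by omega)
    exact hn (h1 ▸ V.normalCore_normal)
  have hmul := V.normalCore.index_mul_card
  rw [hH] at hmul
  have hc2 : Nat.card V.normalCore = 2 := by
    have := Nat.le_of_dvd (by simp) hdvd
    have := Nat.le_of_dvd (by simp) hc4
    interval_cases h : Nat.card V.normalCore <;> omega
  obtain ⟨x, hx⟩ := (Nat.card_eq_two_iff' (1 : V.normalCore)).1 hc2
  obtain ⟨hx1, hxu⟩ := hx
  have : Fact (Nat.Prime 3) := ⟨Nat.prime_three⟩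
  obtain ⟨b, hb⟩ := exists_prime_orderOf_dvd_card' (G := H) 3 (by rw [hH]; norm_num)
  have hcomm : Commute (x : H) b := by
    have h1 := hxu ⟨b * x * b⁻¹, V.normalCore_normal.conj_mem _ x.2 b⟩ (fun h ↦ hx1 (by
      have := congrArg Subtype.val h
      exact Subtype.ext (by simpa using this)))
    have h2 := congrArg Subtype.val h1
    exact (mul_inv_eq_iff_eq_mul.1 h2).symm
  have hx2 : orderOf (x : H) = 2 := by
    rw [Subgroup.orderOf_coe]
    refine orderOf_eq_prime ?_ hx1
    rw [← hc2]
    exact pow_card_eq_one'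
  have := hcomm.orderOf_mul_eq_mul_orderOf_of_coprime (by rw [hx2, hb]; norm_num)
  have := ho (x * b)
  rw [hx2, hb] at *
  omega

lemma exists_klein_of_card_eq_twelve {H : Type*} [Group H] (hH : Nat.card H = 12)
    (ho : ∀ g : H, orderOf g ≤ 3) :
    ∃ a b : H, a ≠ 1 ∧ b ≠ 1 ∧ a * b ≠ 1 ∧ a ^ 2 = 1 ∧ b ^ 2 = 1 ∧ (a * b) ^ 2 = 1 ∧
      ∀ g : H, g ^ 2 = 1 → g = 1 ∨ g = a ∨ g = b ∨ g = a * b := by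
  have : Finite H := Nat.finite_of_card_ne_zero (by simp [hH])
  have : Fact (Nat.Prime 2) := ⟨Nat.prime_two⟩
  obtain ⟨V, hV4⟩ : ∃ V : Subgroup H, Nat.card V = 4 :=
    Sylow.exists_subgroup_card_pow_prime 2 (n := 2) (by rw [hH]; norm_num)
  have hV2 (v : H) (hv : v ∈ V) : v ^ 2 = 1 := by
    have h1 : orderOf v ∣ 2 ^ 2 := by
      have := orderOf_dvd_natCard (⟨v, hv⟩ : V)
      rwa [hV4, ← Subgroup.orderOf_coe] at this
    have h2 := ho v
    obtain ⟨k, hk, hk'⟩ := (Nat.dvd_prime_pow Nat.prime_two).1 h1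
    apply orderOf_dvd_iff_pow_eq_one.1
    rw [hk'] at h2 ⊢
    interval_cases k <;> simp_all
  have hidx : V.index = 3 := by
    have := V.index_mul_card
    rw [hH, hV4] at this
    omega
  have hVn := normal_of_index_three_of_card_eq_twelve hH ho V hidx
  have h2V (g : H) (hg : g ^ 2 = 1) : g ∈ V := by
    have h3 := V.pow_index_mem g
    rw [hidx, pow_succ, hg, one_mul] at h3
    exact h3
  obtain ⟨a, ha⟩ : ∃ a : V, a ≠ 1 := by
    have : Nontrivial V := Finite.one_lt_card_iff_nontrivial.1 (by omega)
    exact exists_ne 1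
  obtain ⟨b, hb⟩ : ∃ b : V, b ≠ 1 ∧ b ≠ a := by
    by_contra! h
    have : (Set.univ : Set V) ⊆ {1, a} := fun b _ ↦ by
      by_cases hb : b = 1
      · simp [hb]
      · simp [h b hb]
    have h1 := Set.ncard_le_ncard this
    rw [Set.ncard_univ, hV4, Set.ncard_pair ha.symm] at h1
    omega
  have hva : a * a = 1 := by rw [← sq]; exact Subtype.ext (hV2 a a.2)
  have hab : a * b ≠ 1 := fun h ↦ hb.2 (mul_left_cancel (h.trans hva.symm))
  have hfour : ({1, a, b, a * b} : Set V) = Set.univ := by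
    refine Set.eq_of_subset_of_ncard_le (Set.subset_univ _) ?_
    rw [Set.ncard_univ, hV4]
    have hab1 : a * b ≠ a := fun h ↦ hb.1 (mul_eq_left.1 h)
    have hab2 : a * b ≠ b := fun h ↦ ha (mul_eq_right.1 h)
    rw [Set.ncard_insert_of_notMem, Set.ncard_insert_of_notMem, Set.ncard_pair hab2.symm] <;>
      simp [hb.2.symm, hab1.symm, ha.symm, hb.1.symm, hab.symm]
  refine ⟨a, b, ?_, ?_, ?_, hV2 _ a.2, hV2 _ b.2, hV2 _ (a * b).2, fun g hg ↦ ?_⟩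
  · exact fun h ↦ ha (Subtype.ext h)
  · exact fun h ↦ hb.1 (Subtype.ext h)
  · exact fun h ↦ hab (Subtype.ext h)
  · have : (⟨g, h2V g hg⟩ : V) ∈ ({1, a, b, a * b} : Set V) := hfour ▸ trivial
    rcases this with h | h | h | h
    · exact .inl (congrArg Subtype.val h)
    · exact .inr (.inl (congrArg Subtype.val h))
    · exact .inr (.inr (.inl (congrArg Subtype.val h)))
    · exact .inr (.inr (.inr (congrArg Subtype.val h)))

section
open Matrix

variable {F : Type*} [Field F]

/-- The invertible matrix with the given entries. -/
def gl2 (a b c d : F) (h : a * d - b * c ≠ 0) : GL (Fin 2) F :=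
  GeneralLinearGroup.mkOfDetNeZero !![a, b; c, d] (by rwa [det_fin_two_of])

@[simp]
lemma coe_gl2 (a b c d : F) (h : a * d - b * c ≠ 0) :
    (gl2 a b c d h : Matrix (Fin 2) (Fin 2) F) = !![a, b; c, d] := rfl

lemma gl2_ext_iff {A B : GL (Fin 2) F} :
    A = B ↔ A 0 0 = B 0 0 ∧ A 0 1 = B 0 1 ∧ A 1 0 = B 1 0 ∧ A 1 1 = B 1 1 := by
  refine ⟨fun h ↦ by simp [h], fun ⟨h1, h2, h3, h4⟩ ↦ ?_⟩
  ext i j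
  fin_cases i <;> fin_cases j <;> assumption

lemma gl2_mul_apply (A B : GL (Fin 2) F) (i j : Fin 2) :
    (A * B) i j = A i 0 * B 0 j + A i 1 * B 1 j := by
  rw [GeneralLinearGroup.coe_mul, mul_apply, Fin.sum_univ_two]

lemma gl2_det_ne_zero (A : GL (Fin 2) F) : A 0 0 * A 1 1 - A 0 1 * A 1 0 ≠ 0 := by
  rw [← det_fin_two]; exact A.det_ne_zero

/-- Upper unitriangular matrices. -/
def upper (y : F) : GL (Fin 2) F := gl2 1 y 0 1 (by simp)

/-- Lower unitriangular matrices. -/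
def lower (y : F) : GL (Fin 2) F := gl2 1 0 y 1 (by simp)

@[simp] lemma coe_upper (y : F) : (upper y : Matrix (Fin 2) (Fin 2) F) = !![1, y; 0, 1] := rfl
@[simp] lemma coe_lower (y : F) : (lower y : Matrix (Fin 2) (Fin 2) F) = !![1, 0; y, 1] := rfl

lemma upper_add (x y : F) : upper (x + y) = upper x * upper y := by
  simp only [gl2_ext_iff, gl2_mul_apply]; simp [add_comm]

lemma lower_add (x y : F) : lower (x + y) = lower x * lower y := by
  simp only [gl2_ext_iff, gl2_mul_apply]; simp [add_comm]

lemma mem_of_upper_lower {N : Subgroup (GL (Fin 2) F)} (hU : ∀ y, upper y ∈ N)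
    (hL : ∀ y, lower y ∈ N) {A : GL (Fin 2) F} (hA : A.val.det = 1) : A ∈ N := by
  have key (B : GL (Fin 2) F) (hB : B.val.det = 1) (hc : B 1 0 ≠ 0) : B ∈ N := by
    have : B = upper ((B 0 0 - 1) / B 1 0) * lower (B 1 0) * upper ((B 1 1 - 1) / B 1 0) := by
      rw [det_fin_two] at hB
      simp only [gl2_ext_iff, gl2_mul_apply]
      simp
      refine ⟨?_, ?_, ?_⟩ <;> field_simp <;> grind
    rw [this]
    exact N.mul_mem (N.mul_mem (hU _) (hL _)) (hU _)
  by_cases hc : A 1 0 = 0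
  · refine (N.mul_mem_cancel_left (hL 1)).1
      (key _ (by rw [GeneralLinearGroup.coe_mul, det_mul, hA]; simp) ?_)
    rw [det_fin_two, hc] at hA
    rw [gl2_mul_apply, hc]
    simp only [coe_lower]
    simp
    rintro h
    simp [h] at hA
  · exact key A hA hc

lemma mem_of_upper {N : Subgroup (GL (Fin 2) F)} (hU : ∀ y, upper y ∈ N) {C : GL (Fin 2) F}
    (hC : C ∈ N) (hc : C 1 0 ≠ 0) {A : GL (Fin 2) F} (hA : A.val.det = 1) : A ∈ N := by
  refine mem_of_upper_lower hU (fun y ↦ ?_) hA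
  set C' := upper (-(C 0 0 / C 1 0)) * C with hC'
  have hC'N : C' ∈ N := N.mul_mem (hU _) hC
  have h00 : C' 0 0 = 0 := by simp only [hC', gl2_mul_apply]; simp [hc]
  have h10 : C' 1 0 = C 1 0 := by simp only [hC', gl2_mul_apply]; simp
  have h01 : C' 0 1 ≠ 0 := fun h ↦ gl2_det_ne_zero C' (by simp [h00, h])
  have : lower y * C' = C' * upper (y * C' 0 1 / C' 1 0) := by
    simp only [gl2_ext_iff, gl2_mul_apply]; simp [h00]
    field_simp [h10 ▸ hc]
  rw [← N.mul_mem_cancel_right hC'N, this]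
  exact N.mul_mem hC'N (hU _)

lemma mem_of_mul_eq_mul {G : Type*} [Group G] {N : Subgroup G} (hN : N.Normal) {z d b : G}
    (hb : b ∈ N) (h : z * d = d * b) : z ∈ N := by
  rw [eq_mul_inv_of_mul_eq h]
  exact hN.conj_mem b hb d

lemma mem_of_normal {N : Subgroup (GL (Fin 2) F)} (hN : N.Normal) {B : GL (Fin 2) F} (hB : B ∈ N)
    (hBs : B ∉ Subgroup.center (GL (Fin 2) F)) {x : F} (hx0 : x ≠ 0) (hx : x ^ 2 ≠ 1)
    {A : GL (Fin 2) F} (hA : A.val.det = 1) : A ∈ N := by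
  obtain ⟨B, hB, hc⟩ : ∃ B ∈ N, B 1 0 ≠ 0 := by
    by_cases hc : B 1 0 = 0
    · by_cases hb : B 0 1 = 0
      · refine ⟨lower 1 * B * (lower 1)⁻¹, hN.conj_mem _ hB _, ?_⟩
        rw [show (lower (1 : F))⁻¹ = lower (-1) by
          refine inv_eq_of_mul_eq_one_right ?_
          rw [← lower_add]; simp [gl2_ext_iff]]
        intro h
        simp only [gl2_mul_apply] at h; simp [hc, hb] at h
        refine hBs (GeneralLinearGroup.mem_center_iff_val_mem_range_scalar.2 ⟨B 0 0, ?_⟩)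
        ext i j
        fin_cases i <;> fin_cases j <;> simp [hc, hb]
        grind
      · refine ⟨gl2 (B 1 1) (B 1 0) (B 0 1) (B 0 0) ?_,
          mem_of_mul_eq_mul (d := gl2 0 1 1 0 (by simp)) hN hB ?_, hb⟩
        · have := gl2_det_ne_zero B
          grind
        · simp only [gl2_ext_iff, gl2_mul_apply]; simp
    · exact ⟨B, hB, hc⟩
  obtain ⟨B, hB, hc, ha⟩ : ∃ B ∈ N, B 1 0 ≠ 0 ∧ B 0 0 = 0 := by
    refine ⟨upper (-(B 0 0 / B 1 0)) * B * (upper (-(B 0 0 / B 1 0)))⁻¹, hN.conj_mem _ hB _, ?_⟩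
    rw [show (upper (-(B 0 0 / B 1 0)))⁻¹ = upper (B 0 0 / B 1 0) by
      refine inv_eq_of_mul_eq_one_right ?_
      rw [← upper_add]; simp [gl2_ext_iff]]
    simp only [gl2_mul_apply]
    simp [hc]
  have hb : B 0 1 ≠ 0 := fun h ↦ gl2_det_ne_zero B (by simp [ha, h])
  obtain ⟨s, hs⟩ : ∃ s, gl2 x 0 s x⁻¹ (by simp [hx0]) ∈ N := by
    refine ⟨-(B 1 1 / B 0 1) * (x⁻¹ - 1), (N.mul_mem_cancel_right hB).1 ?_⟩
    refine mem_of_mul_eq_mul (d := gl2 x 0 0 1 (by simpa)) hN hB ?_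
    simp only [gl2_ext_iff, gl2_mul_apply]; simp [ha]
    field_simp
    grind
  have hL0 : lower (x⁻¹ ^ 2 - 1) ∈ N := by
    rw [sub_eq_add_neg, add_comm, lower_add]
    have h1 : lower (-1) * gl2 x 0 s x⁻¹ (by simp [hx0]) * (lower (-1))⁻¹ *
      (gl2 x 0 s x⁻¹ (by simp [hx0]))⁻¹ ∈ N := N.mul_mem (hN.conj_mem _ hs _) (N.inv_mem hs)
    convert h1 using 1
    rw [eq_mul_inv_iff_mul_eq, eq_mul_inv_iff_mul_eq]
    simp only [gl2_ext_iff, gl2_mul_apply]; simp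
    field_simp
    grind
  have hy0 : x⁻¹ ^ 2 - 1 ≠ 0 := fun h ↦ hx (by
    have : x⁻¹ ^ 2 = 1 := sub_eq_zero.1 h
    rwa [inv_pow, inv_eq_one] at this)
  have hL (y : F) : lower y ∈ N := by
    by_cases hy : y = 0
    · rw [show lower y = 1 by simp [hy, gl2_ext_iff]]
      exact N.one_mem
    · refine mem_of_mul_eq_mul (d := gl2 1 0 0 (y / (x⁻¹ ^ 2 - 1)) (by simp [hy]; simpa using hy0))
        hN hL0 ?_
      simp only [gl2_ext_iff, gl2_mul_apply]; simp
      field_simp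
  refine mem_of_upper_lower (fun y ↦ ?_) hL hA
  refine mem_of_mul_eq_mul (d := gl2 0 1 1 0 (by simp)) hN (hL y) ?_
  simp only [gl2_ext_iff, gl2_mul_apply]; simp

end

section
open Matrix

variable {F : Type*} [Field F]

lemma mem_center_iff_entries {A : GL (Fin 2) F} :
    A ∈ Subgroup.center (GL (Fin 2) F) ↔ A 0 1 = 0 ∧ A 1 0 = 0 ∧ A 0 0 = A 1 1 := by
  rw [GeneralLinearGroup.mem_center_iff_val_mem_range_scalar]
  constructor
  · rintro ⟨a, ha⟩
    simp [← ha]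
  · rintro ⟨h1, h2, h3⟩
    refine ⟨A 0 0, ?_⟩
    ext i j
    fin_cases i <;> fin_cases j <;> simp [h1, h2, h3]

lemma pow_char_mem_center {p : ℕ} [hp : Fact p.Prime] [CharP F p] [NeZero (2 : F)]
    {A : GL (Fin 2) F} (hA : A.val.discr = 0) : A ^ p ∈ Subgroup.center (GL (Fin 2) F) := by
  rw [GeneralLinearGroup.mem_center_iff_val_mem_range_scalar]
  refine ⟨(A.val.trace / 2) ^ p, ?_⟩
  have h2 := sub_scalar_sq_eq_discr (m := A.val)
  rw [hA, zero_div, map_zero] at h2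
  have h3 := pow_eq_zero_of_le hp.out.two_le h2
  rw [sub_pow_char_of_commute _ (scalar_commute _ (fun r ↦ Commute.all _ r) _).symm] at h3
  rw [map_pow, Units.val_pow_eq_pow_val]
  exact (sub_eq_zero.1 h3).symm

lemma discr_eq_zero_of_pow_char {p : ℕ} [hp : Fact p.Prime] {A : GL (Fin 2) (ZMod p)}
    (hA : A ^ p ∈ Subgroup.center (GL (Fin 2) (ZMod p))) : A.val.discr = 0 := by
  obtain ⟨s, hs⟩ := GeneralLinearGroup.mem_center_iff_val_mem_range_scalar.1 hA
  have hN : (A.val - scalar (Fin 2) s) ^ p = 0 := by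
    rw [sub_pow_char_of_commute _ (scalar_commute _ (fun r ↦ Commute.all _ r) _).symm, ← map_pow,
      ZMod.pow_card, hs, Units.val_pow_eq_pow_val, sub_self]
  have hdet : (A.val - scalar (Fin 2) s).det = 0 := by
    have := congrArg det hN
    rw [det_pow, det_zero] at this
    exact pow_eq_zero_iff hp.out.ne_zero |>.1 this
  have htr : (A.val - scalar (Fin 2) s).trace = 0 :=
    (isNilpotent_trace_of_isNilpotent ⟨p, hN⟩).eq_zero
  rw [det_fin_two] at hdet
  rw [trace_fin_two] at htr
  rw [discr_fin_two, trace_fin_two, det_fin_two]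
  simp at hdet htr
  grind

lemma exists_conj_upper [NeZero (2 : F)] {A : GL (Fin 2) F} (hA : A.val.discr = 0)
    (hAc : A ∉ Subgroup.center (GL (Fin 2) F)) :
    ∃ (Q : GL (Fin 2) F) (s t : F) (hs : s ≠ 0), t ≠ 0 ∧
      A * Q = Q * gl2 s t 0 s (by simpa using hs) := by
  have h20 := NeZero.ne (2 : F)
  rw [discr_fin_two, trace_fin_two, det_fin_two] at hA
  have hdet := gl2_det_ne_zero A
  rw [mem_center_iff_entries] at hAc
  have hs : (A 0 0 + A 1 1) / 2 ≠ 0 := by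
    intro h
    have : A 0 0 + A 1 1 = 0 := by simpa [h20] using h
    rw [this] at hA
    apply hdet
    have h4 : (2 * 2 : F) ≠ 0 := by simp [h20]
    refine (mul_eq_zero.1 (?_ : (2 * 2 : F) * _ = 0)).resolve_left h4
    linear_combination -hA
  by_cases hc : A 1 0 = 0
  · have hd : A 0 0 = A 1 1 := by
      have : (A 0 0 - A 1 1) ^ 2 = 0 := by rw [hc] at hA; linear_combination hA
      exact sub_eq_zero.1 (pow_eq_zero_iff two_ne_zero |>.1 this)
    refine ⟨1, _, A 0 1, hs, fun h ↦ hAc ⟨h, hc, hd⟩, ?_⟩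
    simp only [gl2_ext_iff, one_mul, mul_one]
    simp [hc, hd]
  · refine ⟨gl2 ((A 0 0 - A 1 1) / 2) 1 (A 1 0) 0 (by simpa using hc), _, 1, hs, one_ne_zero, ?_⟩
    simp only [gl2_ext_iff, gl2_mul_apply]
    simp
    refine ⟨?_, ?_, ?_⟩ <;> field_simp <;> first | ring1 | linear_combination hA

/-- For an element of `GL₂` fixing the point `x` of the projective line, the eigenvalue on the
corresponding line. -/
def eigenvalueAt (A : GL (Fin 2) F) (x : OnePoint F) : F :=
  x.elim (A 0 0) fun z ↦ A 1 0 * z + A 1 1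

section

variable [DecidableEq F]

lemma smul_coe_eq_self_iff {A : GL (Fin 2) F} {z : F} :
    A • (z : OnePoint F) = z ↔ A 0 0 * z + A 0 1 = z * (A 1 0 * z + A 1 1) := by
  rw [← GeneralLinearGroup.fixpointPolynomial_aeval_eq_zero_iff]
  simp [GeneralLinearGroup.fixpointPolynomial]
  grind

lemma eigenvalueAt_mul {A B : GL (Fin 2) F} {x : OnePoint F} (hB : B • x = x) :
    eigenvalueAt (A * B) x = eigenvalueAt A x * eigenvalueAt B x := by
  induction x with
  | infty =>
    rw [OnePoint.smul_infty_eq_self_iff] at hB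
    simp only [eigenvalueAt, OnePoint.elim_infty, gl2_mul_apply, hB]
    ring
  | coe z =>
    rw [smul_coe_eq_self_iff] at hB
    simp only [eigenvalueAt, OnePoint.elim_some, gl2_mul_apply]
    linear_combination A 1 0 * hB

lemma eigenvalueAt_ne_zero {A : GL (Fin 2) F} {x : OnePoint F} (hA : A • x = x) :
    eigenvalueAt A x ≠ 0 := by
  have h1 : eigenvalueAt (1 : GL (Fin 2) F) x = 1 := by
    induction x <;> simp [eigenvalueAt]
  have h2 := eigenvalueAt_mul (A := A⁻¹) hA
  rw [inv_mul_cancel, h1] at h2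
  exact right_ne_zero_of_mul (h2 ▸ one_ne_zero)

lemma discr_eq_zero_of_eigenvalueAt_sq [NeZero (2 : F)] {A : GL (Fin 2) F} {x : OnePoint F}
    (hA : A • x = x) (h : eigenvalueAt A x ^ 2 = A.val.det) : A.val.discr = 0 := by
  have h0 := eigenvalueAt_ne_zero hA
  rw [det_fin_two] at h
  rw [discr_fin_two, trace_fin_two, det_fin_two]
  induction x with
  | infty =>
    rw [OnePoint.smul_infty_eq_self_iff] at hA
    simp only [eigenvalueAt, OnePoint.elim_infty] at h h0
    rw [hA] at h ⊢
    have : A 0 0 = A 1 1 := mul_left_cancel₀ h0 (by linear_combination h)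
    rw [this]; ring
  | coe z =>
    rw [smul_coe_eq_self_iff] at hA
    simp only [eigenvalueAt, OnePoint.elim_some] at h h0
    have : A 0 0 + A 1 1 = 2 * (A 1 0 * z + A 1 1) := mul_left_cancel₀ h0 (by
      linear_combination A 1 0 * hA - h)
    rw [this, ← h]; ring

lemma ncard_fixedBy_of_discr_ne_zero [NeZero (2 : F)] [IsAlgClosed F] {A : GL (Fin 2) F}
    (hA : A.val.discr ≠ 0) : (MulAction.fixedBy (OnePoint F) A).ncard = 2 := by
  rw [discr_fin_two, trace_fin_two, det_fin_two] at hA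
  have h20 := NeZero.ne (2 : F)
  rw [Set.ncard_eq_two]
  by_cases hc : A 1 0 = 0
  · have hd : A 0 0 - A 1 1 ≠ 0 := fun h ↦ hA (by
      rw [hc, sub_eq_zero.1 h]; ring)
    refine ⟨OnePoint.infty, ((-(A 0 1 / (A 0 0 - A 1 1)) : F) : OnePoint F),
      OnePoint.infty_ne_coe _, ?_⟩
    ext x
    rw [MulAction.mem_fixedBy]
    induction x with
    | infty => simp [OnePoint.smul_infty_eq_self_iff, hc]
    | coe z =>
      rw [smul_coe_eq_self_iff, hc]
      simp
      field_simp
      grind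
  · obtain ⟨r, hr⟩ := IsAlgClosed.exists_pow_nat_eq
      ((A 0 0 + A 1 1) ^ 2 - 4 * (A 0 0 * A 1 1 - A 0 1 * A 1 0)) (n := 2) (by simp)
    have hr0 : r ≠ 0 := fun h ↦ hA (by rw [← hr, h]; ring)
    refine ⟨(((A 0 0 - A 1 1 + r) / (2 * A 1 0) : F) : OnePoint F),
      (((A 0 0 - A 1 1 - r) / (2 * A 1 0) : F) : OnePoint F), ?_, ?_⟩
    · intro h
      rw [OnePoint.coe_eq_coe, div_left_inj' (by simp [h20, hc])] at h
      have : 2 * r = 0 := by linear_combination h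
      simp [h20, hr0] at this
    · ext x
      rw [MulAction.mem_fixedBy]
      induction x with
      | infty => simp [OnePoint.smul_infty_eq_self_iff, hc]
      | coe z =>
        rw [smul_coe_eq_self_iff]
        simp only [Set.mem_insert_iff, Set.mem_singleton_iff, OnePoint.coe_eq_coe]
        have h2c : 2 * A 1 0 ≠ 0 := by simp [h20, hc]
        rw [eq_div_iff h2c, eq_div_iff h2c, ← sub_eq_zero, ← sub_eq_zero (b := A 0 0 - A 1 1 + r),
          ← sub_eq_zero (b := A 0 0 - A 1 1 - r), ← mul_eq_zero, ← mul_right_inj' (a := -(4 * A 1 0))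
          (by rw [show (4 : F) = 2 * 2 by norm_num]; simp [h20, hc]), mul_zero]
        refine Eq.congr_left ?_
        linear_combination hr

end

end

section
open Matrix

variable {p : ℕ} [hp : Fact p.Prime]

/-- The extension of scalars from `𝔽_p` to its algebraic closure. -/
noncomputable def glClosure : GL (Fin 2) (ZMod p) →* GL (Fin 2) (AlgebraicClosure (ZMod p)) :=
  GeneralLinearGroup.map (algebraMap (ZMod p) (AlgebraicClosure (ZMod p)))

lemma glClosure_apply (A : GL (Fin 2) (ZMod p)) (i j : Fin 2) :
    glClosure A i j = algebraMap (ZMod p) (AlgebraicClosure (ZMod p)) (A i j) := rfl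

lemma discr_glClosure (A : GL (Fin 2) (ZMod p)) :
    (glClosure A).val.discr = algebraMap (ZMod p) (AlgebraicClosure (ZMod p)) A.val.discr := by
  simp [discr_fin_two, trace_fin_two, det_fin_two, glClosure_apply,
    map_ofNat (algebraMap (ZMod p) (AlgebraicClosure (ZMod p))) 4]

noncomputable instance : DecidableEq (AlgebraicClosure (ZMod p)) := Classical.decEq _

lemma glClosure_smul_of_mem_center {A : GL (Fin 2) (ZMod p)}
    (hA : A ∈ Subgroup.center (GL (Fin 2) (ZMod p)))
    (x : OnePoint (AlgebraicClosure (ZMod p))) : glClosure A • x = x := by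
  obtain ⟨h1, h2, h3⟩ := mem_center_iff_entries.1 hA
  induction x with
  | infty => simp [OnePoint.smul_infty_eq_self_iff, glClosure_apply, h2]
  | coe z =>
    rw [smul_coe_eq_self_iff]
    simp [glClosure_apply, h1, h2, h3, mul_comm]

/-- `PGL(2, p)` acts on the projective line over the algebraic closure of `𝔽_p`. -/
noncomputable instance : MulAction (PGL 2 p) (OnePoint (AlgebraicClosure (ZMod p))) :=
  MulAction.compHom _ (QuotientGroup.lift (Subgroup.center (GL (Fin 2) (ZMod p)))
    ((MulAction.toPermHom (GL (Fin 2) (AlgebraicClosure (ZMod p)))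
      (OnePoint (AlgebraicClosure (ZMod p)))).comp glClosure)
    fun _ hA ↦ Equiv.ext (glClosure_smul_of_mem_center hA))

lemma mk_smul (A : GL (Fin 2) (ZMod p)) (x : OnePoint (AlgebraicClosure (ZMod p))) :
    (A : PGL 2 p) • x = glClosure A • x := rfl

lemma mk_eq_one_iff {A : GL (Fin 2) (ZMod p)} :
    (A : PGL 2 p) = 1 ↔ A ∈ Subgroup.center (GL (Fin 2) (ZMod p)) :=
  QuotientGroup.eq_one_iff A

lemma mk_pow_char_eq_one_iff [NeZero (2 : ZMod p)] {A : GL (Fin 2) (ZMod p)} :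
    (A : PGL 2 p) ^ p = 1 ↔ A.val.discr = 0 := by
  rw [← QuotientGroup.mk_pow, mk_eq_one_iff]
  exact ⟨discr_eq_zero_of_pow_char, pow_char_mem_center⟩

instance [NeZero (2 : ZMod p)] : NeZero (2 : AlgebraicClosure (ZMod p)) := by
  refine ⟨?_⟩
  rw [← map_ofNat (algebraMap (ZMod p) (AlgebraicClosure (ZMod p))) 2]
  simpa only [ne_eq, map_eq_zero] using NeZero.ne (2 : ZMod p)

lemma ncard_fixedBy_of_pow_char_ne_one [NeZero (2 : ZMod p)] {g : PGL 2 p} (hg : g ^ p ≠ 1) :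
    (MulAction.fixedBy (OnePoint (AlgebraicClosure (ZMod p))) g).ncard = 2 := by
  induction g using QuotientGroup.induction_on with | H A =>
  rw [ne_eq, mk_pow_char_eq_one_iff] at hg
  refine ncard_fixedBy_of_discr_ne_zero (A := glClosure A) ?_
  rwa [discr_glClosure, ne_eq, map_eq_zero]

/-- The ratio of the eigenvalue at a fixed point to the other one. -/
noncomputable def eigenvalueRatio (A : GL (Fin 2) (ZMod p))
    (x : OnePoint (AlgebraicClosure (ZMod p))) : AlgebraicClosure (ZMod p) :=
  eigenvalueAt (glClosure A) x ^ 2 / (glClosure A).val.det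

lemma eigenvalueRatio_mul {A B : GL (Fin 2) (ZMod p)} {x : OnePoint (AlgebraicClosure (ZMod p))}
    (hB : glClosure B • x = x) :
    eigenvalueRatio (A * B) x = eigenvalueRatio A x * eigenvalueRatio B x := by
  rw [eigenvalueRatio, map_mul, eigenvalueAt_mul hB, GeneralLinearGroup.coe_mul, det_mul,
    mul_pow, mul_div_mul_comm, eigenvalueRatio, eigenvalueRatio]

lemma eigenvalueRatio_of_mem_center {A : GL (Fin 2) (ZMod p)}
    (hA : A ∈ Subgroup.center (GL (Fin 2) (ZMod p)))
    (x : OnePoint (AlgebraicClosure (ZMod p))) : eigenvalueRatio A x = 1 := by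
  have h0 := gl2_det_ne_zero (glClosure A)
  obtain ⟨h1, h2, h3⟩ := mem_center_iff_entries.1 hA
  rw [eigenvalueRatio, det_fin_two, div_eq_one_iff_eq h0]
  induction x <;> simp [eigenvalueAt, glClosure_apply, h1, h2, h3, sq]

lemma eigenvalueRatio_eq_of_mk_eq {A B : GL (Fin 2) (ZMod p)} (h : (A : PGL 2 p) = B)
    (x : OnePoint (AlgebraicClosure (ZMod p))) : eigenvalueRatio A x = eigenvalueRatio B x := by
  have hc : A⁻¹ * B ∈ Subgroup.center (GL (Fin 2) (ZMod p)) := QuotientGroup.eq.1 h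
  have := eigenvalueRatio_mul (A := A) (glClosure_smul_of_mem_center hc x)
  rw [mul_inv_cancel_left, eigenvalueRatio_of_mem_center hc, mul_one] at this
  exact this.symm

lemma eigenvalueRatio_ne_zero {A : GL (Fin 2) (ZMod p)} {x : OnePoint (AlgebraicClosure (ZMod p))}
    (hA : glClosure A • x = x) : eigenvalueRatio A x ≠ 0 :=
  div_ne_zero (pow_ne_zero _ (eigenvalueAt_ne_zero hA)) (glClosure A).det_ne_zero

lemma glClosure_out_smul {g : PGL 2 p} {x : OnePoint (AlgebraicClosure (ZMod p))}
    (hg : g • x = x) : glClosure g.out • x = x := by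
  rwa [← mk_smul, QuotientGroup.out_eq']

/-- The character of a point stabilizer in `PGL(2, p)` given by the ratio of eigenvalues. -/
noncomputable def stabilizerCharacter (x : OnePoint (AlgebraicClosure (ZMod p))) :
    MulAction.stabilizer (PGL 2 p) x →* (AlgebraicClosure (ZMod p))ˣ :=
  MonoidHom.mk' (fun g ↦ Units.mk0 (eigenvalueRatio g.1.out x)
    (eigenvalueRatio_ne_zero (glClosure_out_smul g.2))) fun g h ↦ Units.ext (by
      simp only [Units.val_mk0, Units.val_mul]
      rw [← eigenvalueRatio_mul (glClosure_out_smul h.2)]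
      apply eigenvalueRatio_eq_of_mk_eq
      simp)

lemma pow_char_eq_one_of_stabilizerCharacter_eq_one [NeZero (2 : ZMod p)]
    {x : OnePoint (AlgebraicClosure (ZMod p))} (g : MulAction.stabilizer (PGL 2 p) x)
    (hg : stabilizerCharacter x g = 1) : g ^ p = 1 := by
  apply Subtype.ext
  change g.1 ^ p = 1
  rw [← QuotientGroup.out_eq' g.1, mk_pow_char_eq_one_iff]
  have h1 : eigenvalueRatio g.1.out x = 1 := congrArg Units.val hg
  rw [eigenvalueRatio, div_eq_one_iff_eq (GeneralLinearGroup.det_ne_zero _)] at h1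
  have := discr_eq_zero_of_eigenvalueAt_sq (glClosure_out_smul g.2) h1
  rwa [discr_glClosure, map_eq_zero] at this

lemma isSupersolvable_of_large_stabilizer [NeZero (2 : ZMod p)] {H : Subgroup (PGL 2 p)}
    (hH : ¬ p ^ 2 ∣ Nat.card H) (x : OnePoint (AlgebraicClosure (ZMod p)))
    (hx : Nat.card H ≤ 2 * Nat.card (MulAction.stabilizer H x)) : IsSupersolvable H := by
  let ι : MulAction.stabilizer H x →* MulAction.stabilizer (PGL 2 p) x :=
    { toFun := fun h ↦ ⟨h.1.1, h.2⟩, map_one' := rfl, map_mul' := fun _ _ ↦ rfl }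
  have hι : Function.Injective ι := fun a b h ↦ Subtype.ext (Subtype.ext (congrArg (fun g ↦ g.1) h))
  refine isSupersolvable_of_character p hH _ hx ((stabilizerCharacter x).comp ι) fun c hc ↦ hι ?_
  rw [map_pow, pow_char_eq_one_of_stabilizerCharacter_eq_one _ hc, map_one]

end

section
open Matrix

variable {p : ℕ} [hp : Fact p.Prime]

lemma mk_eq_mk_iff {A B : GL (Fin 2) (ZMod p)} :
    (A : PGL 2 p) = B ↔ ∃ c, c ≠ 0 ∧ ∀ i j, B i j = A i j * c := by
  rw [QuotientGroup.eq]
  constructor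
  · intro h
    obtain ⟨h1, h2, h3⟩ := mem_center_iff_entries.1 h
    refine ⟨(A⁻¹ * B) 0 0, fun h0 ↦ gl2_det_ne_zero (A⁻¹ * B) (by rw [h0, h1]; ring), fun i j ↦ ?_⟩
    rw [← mul_inv_cancel_left A B, gl2_mul_apply, inv_mul_cancel_left]
    fin_cases j <;> simp [-mul_inv_cancel_left, h1, h2, h3]
  · rintro ⟨c, hc, h⟩
    have : B = A * gl2 c 0 0 c (by simpa using hc) := by
      simp only [gl2_ext_iff, gl2_mul_apply]
      simp [h]
    rw [this, inv_mul_cancel_left, mem_center_iff_entries]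
    simp

/-- The image of `SL(2, p)` in `PGL(2, p)`. -/
def PSL (p : ℕ) [Fact p.Prime] : Subgroup (PGL 2 p) :=
  (GeneralLinearGroup.det (n := Fin 2) (R := ZMod p)).ker.map (QuotientGroup.mk' _)

instance : (PSL p).Normal :=
  (MonoidHom.normal_ker _).map _ (QuotientGroup.mk'_surjective _)

lemma PSL_le_iff {N : Subgroup (PGL 2 p)} :
    PSL p ≤ N ↔ ∀ A : GL (Fin 2) (ZMod p), A.val.det = 1 → (A : PGL 2 p) ∈ N := by
  rw [PSL, Subgroup.map_le_iff_le_comap]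
  refine forall_congr' fun A ↦ ?_
  rw [MonoidHom.mem_ker, Units.ext_iff]
  rfl

lemma mk_mem_PSL_iff {A : GL (Fin 2) (ZMod p)} : (A : PGL 2 p) ∈ PSL p ↔ IsSquare A.val.det := by
  constructor
  · rintro ⟨B, hB, h⟩
    have hc : B⁻¹ * A ∈ Subgroup.center (GL (Fin 2) (ZMod p)) := QuotientGroup.eq.1 h
    obtain ⟨h1, h2, h3⟩ := mem_center_iff_entries.1 hc
    have hB : B.val.det = 1 := congrArg Units.val hB
    have hA : A.val.det = (B⁻¹ * A).val.det := by
      rw [← one_mul (B⁻¹ * A).val.det, ← hB, ← det_mul, ← GeneralLinearGroup.coe_mul,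
        mul_inv_cancel_left]
    exact ⟨(B⁻¹ * A) 0 0, by rw [hA, det_fin_two, h1, ← h3]; simp⟩
  · rintro ⟨r, hr⟩
    have hr0 : r ≠ 0 := fun h ↦ A.det_ne_zero (by rw [hr, h, mul_zero])
    let s := gl2 r⁻¹ 0 0 r⁻¹ (by simpa using hr0)
    refine ⟨A * s, ?_, QuotientGroup.eq.2 ?_⟩
    · refine Units.ext ?_
      change (A * s).val.det = 1
      rw [GeneralLinearGroup.coe_mul, det_mul, hr]
      simp [s]
      field_simp
    · rw [_root_.mul_inv_rev, inv_mul_cancel_right, inv_mem_iff, mem_center_iff_entries]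
      simp [s]

lemma mul_mem_PSL {g h : PGL 2 p} (hg : g ∉ PSL p) (hh : h ∉ PSL p) : g * h ∈ PSL p := by
  induction g using QuotientGroup.induction_on with | H A =>
  induction h using QuotientGroup.induction_on with | H B =>
  rw [mk_mem_PSL_iff] at hg hh
  rw [← QuotientGroup.mk_mul, mk_mem_PSL_iff, GeneralLinearGroup.coe_mul, det_mul]
  by_contra hgh
  have := map_mul (quadraticChar (ZMod p)) A.val.det B.val.det
  rw [quadraticChar_neg_one_iff_not_isSquare.2 hg, quadraticChar_neg_one_iff_not_isSquare.2 hh,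
    quadraticChar_neg_one_iff_not_isSquare.2 hgh] at this
  norm_num at this

lemma PSL_ne_top (hp2 : p ≠ 2) : PSL p ≠ ⊤ := by
  intro h
  obtain ⟨a, ha⟩ := FiniteField.exists_nonsquare (F := ZMod p) (by rwa [ZMod.ringChar_zmod_n])
  have ha0 : a ≠ 0 := fun h ↦ ha (h ▸ IsSquare.zero)
  have := mk_mem_PSL_iff.1
    (h ▸ Subgroup.mem_top ((gl2 a 0 0 1 (by simpa) : GL (Fin 2) (ZMod p)) : PGL 2 p))
  simp [ha] at this

lemma two_ne_zero_of_five_le (hp5 : 5 ≤ p) : (2 : ZMod p) ≠ 0 := by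
  intro h
  have h2 : ((2 : ℕ) : ZMod p) = 0 := by exact_mod_cast h
  rw [ZMod.natCast_eq_zero_iff] at h2
  exact absurd (Nat.le_of_dvd (by norm_num) h2) (by omega)

lemma PSL_le_of_normal (hp5 : 5 ≤ p) {N : Subgroup (PGL 2 p)} (hN : N.Normal) (h : N ≠ ⊥) :
    PSL p ≤ N := by
  obtain ⟨g, hg, hg1⟩ := N.bot_or_exists_ne_one.resolve_left h
  induction g using QuotientGroup.induction_on with | H B =>
  rw [ne_eq, mk_eq_one_iff] at hg1
  have h2 : (2 : ZMod p) ≠ 0 := two_ne_zero_of_five_le hp5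
  have h3 : (2 : ZMod p) ^ 2 ≠ 1 := by
    intro h
    have h3 : ((3 : ℕ) : ZMod p) = 0 := by push_cast; linear_combination h
    rw [ZMod.natCast_eq_zero_iff] at h3
    exact absurd (Nat.le_of_dvd (by norm_num) h3) (by omega)
  rw [PSL_le_iff]
  exact fun A hA ↦ mem_of_normal (N := N.comap (QuotientGroup.mk' _)) inferInstance hg hg1 h2 h3 hA

lemma PSL_ne_bot : PSL p ≠ ⊥ := by
  intro h
  have hu : ((upper 1 : GL (Fin 2) (ZMod p)) : PGL 2 p) ∈ PSL p := by simp [mk_mem_PSL_iff]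
  rw [h, Subgroup.mem_bot, mk_eq_one_iff, mem_center_iff_entries] at hu
  simp at hu

lemma PSL_le_derivedSeries (hp5 : 5 ≤ p) (n : ℕ) : PSL p ≤ derivedSeries (PGL 2 p) n := by
  induction n with
  | zero => simp
  | succ n ih =>
    refine le_trans (PSL_le_of_normal hp5 (N := ⁅PSL p, PSL p⁆) inferInstance ?_)
      (Subgroup.commutator_mono ih ih)
    rw [ne_eq, Subgroup.commutator_eq_bot_iff_le_centralizer]
    intro h
    have hu : ((upper 1 : GL (Fin 2) (ZMod p)) : PGL 2 p) ∈ PSL p := by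
      simp [mk_mem_PSL_iff]
    have hl : ((lower 1 : GL (Fin 2) (ZMod p)) : PGL 2 p) ∈ PSL p := by
      simp [mk_mem_PSL_iff]
    obtain ⟨c, -, hc⟩ := mk_eq_mk_iff.1 (h hu _ hl)
    have h1 := hc 0 0
    have h2 := hc 1 0
    have h3 := hc 1 1
    simp only [gl2_mul_apply] at h1 h2 h3
    simp at h1 h2 h3
    simp [← h2] at h1

lemma not_isSolvable_PGL (hp5 : 5 ≤ p) : ¬ Group.IsSolvable (PGL 2 p) := by
  rintro ⟨n, hn⟩
  exact PSL_ne_bot (le_bot_iff.1 (hn ▸ PSL_le_derivedSeries hp5 n))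

lemma not_sq_dvd_card {H : Subgroup (PGL 2 p)} : ¬ p ^ 2 ∣ Nat.card H := by
  intro h
  replace h := (h.trans H.card_subgroup_dvd_card).trans
    ((Subgroup.center (GL (Fin 2) (ZMod p))).card_quotient_dvd_card)
  have hlt : p < p ^ 2 := by nlinarith [hp.out.two_le]
  rw [card_GL_field, Fin.prod_univ_two, ZMod.card] at h
  simp only [Fin.val_zero, Fin.val_one, pow_zero, pow_one] at h
  have hcop : Nat.Coprime (p ^ 2) (p ^ 2 - 1) :=
    (Nat.coprime_self_sub_right (by omega)).2 (Nat.coprime_one_right _)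
  exact absurd (Nat.le_of_dvd (by omega) (hcop.dvd_of_dvd_mul_left h))
    (by have := hp.out.pos; omega)

end

section
open Matrix

variable {p : ℕ} [hp : Fact p.Prime]

lemma upper_nsmul {F : Type*} [Field F] (n : ℕ) (x : F) : upper (n • x) = upper x ^ n := by
  induction n with
  | zero => simp [gl2_ext_iff]
  | succ n ih => rw [succ_nsmul, upper_add, ih, pow_succ]

/-- A subgroup of `PGL(2, p)` of order divisible by `p` contains the image of `SL(2, p)` or fixes
a point of the projective line. -/
lemma PSL_le_or_exists_fixedPoint [NeZero (2 : ZMod p)] {M : Subgroup (PGL 2 p)}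
    (hM : p ∣ Nat.card M) : PSL p ≤ M ∨
      ∃ x : OnePoint (AlgebraicClosure (ZMod p)), ∀ g ∈ M, g • x = x := by
  obtain ⟨⟨u, huM⟩, hu⟩ := exists_prime_orderOf_dvd_card' p hM
  rw [Subgroup.orderOf_mk] at hu
  induction u using QuotientGroup.induction_on with | H A =>
  have hA := mk_pow_char_eq_one_iff.1 (hu ▸ pow_orderOf_eq_one (A : PGL 2 p))
  have hAc : A ∉ Subgroup.center (GL (Fin 2) (ZMod p)) := fun h ↦ by
    rw [mk_eq_one_iff.2 h, orderOf_one] at hu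
    exact hp.out.one_lt.ne hu
  obtain ⟨Q, s, t, hs, ht, h⟩ := exists_conj_upper hA hAc
  by_cases hfix : ∀ B : GL (Fin 2) (ZMod p), (B : PGL 2 p) ∈ M → (Q⁻¹ * B * Q) 1 0 = 0
  · refine .inr ⟨glClosure Q • OnePoint.infty, fun g hg ↦ ?_⟩
    induction g using QuotientGroup.induction_on with | H B =>
    rw [mk_smul, ← inv_smul_eq_iff, ← map_inv, smul_smul, smul_smul, ← map_mul, ← map_mul,
      OnePoint.smul_infty_eq_self_iff, glClosure_apply, hfix B hg, map_zero]
  · push Not at hfix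
    obtain ⟨B, hBM, hB⟩ := hfix
    let N : Subgroup (GL (Fin 2) (ZMod p)) :=
      (M.comap (QuotientGroup.mk' _)).comap (MulAut.conj Q).toMonoidHom
    have hN (C : GL (Fin 2) (ZMod p)) :
        C ∈ N ↔ ((Q * C * Q⁻¹ : GL (Fin 2) (ZMod p)) : PGL 2 p) ∈ M :=
      Iff.rfl
    have h1 : gl2 s t 0 s (by simpa using hs) ∈ N := by
      rw [hN, ← h, mul_inv_cancel_right]
      exact huM
    have h2 : gl2 s⁻¹ 0 0 s⁻¹ (by simpa using hs) ∈ N := by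
      have hc : gl2 s⁻¹ 0 0 s⁻¹ (by simpa using hs) ∈ Subgroup.center (GL (Fin 2) (ZMod p)) := by
        rw [mem_center_iff_entries]; simp
      rw [hN, Subgroup.mem_center_iff.1 hc Q, mul_inv_cancel_right, mk_eq_one_iff.2 hc]
      exact M.one_mem
    have h3 : upper (t / s) ∈ N := by
      convert N.mul_mem h1 h2 using 1
      simp only [gl2_ext_iff, gl2_mul_apply]
      simp [hs, div_eq_mul_inv]
    have hU (y : ZMod p) : upper y ∈ N := by
      have : y = (y * s / t).val • (t / s) := by
        rw [nsmul_eq_mul, ZMod.natCast_zmod_val]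
        field_simp
      rw [this, upper_nsmul]
      exact N.pow_mem h3 _
    refine .inl (PSL_le_iff.2 fun A hA ↦ ?_)
    have hBN : Q⁻¹ * B * Q ∈ N := by
      rw [hN]
      convert hBM using 2
      group
    have := mem_of_upper hU hBN hB (A := Q⁻¹ * A * Q) (by
      rw [GeneralLinearGroup.coe_mul, det_mul, mul_comm, ← det_mul, ← GeneralLinearGroup.coe_mul,
        mul_inv_cancel_left, hA])
    rw [hN] at this
    convert this using 2
    group

end

section
open Matrix

variable {p : ℕ} [hp : Fact p.Prime]

lemma trace_eq_zero_of_mk_sq {A : GL (Fin 2) (ZMod p)} (h1 : (A : PGL 2 p) ≠ 1)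
    (h2 : (A : PGL 2 p) ^ 2 = 1) : A 0 0 + A 1 1 = 0 := by
  rw [← QuotientGroup.mk_pow, mk_eq_one_iff, sq, mem_center_iff_entries] at h2
  rw [ne_eq, mk_eq_one_iff, mem_center_iff_entries] at h1
  simp only [gl2_mul_apply] at h2
  by_contra h
  obtain ⟨e1, e2, e3⟩ := h2
  refine h1 ⟨mul_left_cancel₀ h ?_, mul_left_cancel₀ h ?_, mul_left_cancel₀ h ?_⟩
  · linear_combination e1
  · linear_combination e2
  · linear_combination e3

/-- When `2` is a square, each involution of a Klein four-subgroup of the image of `SL(2, p)`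
is the square of an element normalizing that subgroup and exchanging the other involutions. -/
lemma exists_sq_eq_of_klein (h20 : (2 : ZMod p) ≠ 0) (h2 : IsSquare (2 : ZMod p)) {a b : PGL 2 p}
    (ha : a ∈ PSL p) (hb : b ∈ PSL p) (ha1 : a ≠ 1) (hb1 : b ≠ 1) (hab1 : a * b ≠ 1)
    (ha2 : a ^ 2 = 1) (hb2 : b ^ 2 = 1) (hab2 : (a * b) ^ 2 = 1) :
    ∃ w ∈ PSL p, w ^ 2 = a ∧ w * b = a * b * w := by
  obtain ⟨A, hA, rfl⟩ := ha
  obtain ⟨B, hB, rfl⟩ := hb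
  have hA : A.val.det = 1 := congrArg Units.val hA
  rw [det_fin_two] at hA
  have htA := trace_eq_zero_of_mk_sq ha1 ha2
  have htB := trace_eq_zero_of_mk_sq hb1 hb2
  have htAB := trace_eq_zero_of_mk_sq (A := A * B) hab1 hab2
  simp only [gl2_mul_apply] at htAB
  have hA11 : A 1 1 = -A 0 0 := by linear_combination htA
  have hB11 : B 1 1 = -B 0 0 := by linear_combination htB
  rw [hA11] at hA htAB
  rw [hB11] at htAB
  have hdet : (1 + A 0 0) * (1 - A 0 0) - A 0 1 * A 1 0 = 2 := by linear_combination hA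
  let W := gl2 (1 + A 0 0) (A 0 1) (A 1 0) (1 - A 0 0) (hdet ▸ h20)
  refine ⟨W, ?_, ?_, ?_⟩
  · rw [mk_mem_PSL_iff]
    simpa [W, hdet] using h2
  · change ((W ^ 2 : GL (Fin 2) (ZMod p)) : PGL 2 p) = (A : PGL 2 p)
    refine Eq.symm (mk_eq_mk_iff.2 ⟨2, h20, fun i j ↦ ?_⟩)
    rw [sq, gl2_mul_apply]
    fin_cases i <;> fin_cases j <;> simp [W] <;> grind
  · change ((W * B : GL (Fin 2) (ZMod p)) : PGL 2 p) = (A * B * W : GL (Fin 2) (ZMod p))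
    congr 1
    simp only [gl2_ext_iff, gl2_mul_apply]
    simp [W]
    grind

lemma card_eq_two_mul_card_inf_PSL {T : Subgroup (PGL 2 p)} (hT : ¬ T ≤ PSL p) :
    Nat.card T = 2 * Nat.card ↥(T ⊓ PSL p) := by
  have h1 : (PSL p).relIndex T ∣ 2 := by
    refine (Subgroup.relIndex_dvd_index_of_normal _ _).trans ?_
    rw [Subgroup.index_eq_two_iff.2]
    obtain ⟨a, haT, ha⟩ := SetLike.not_le_iff_exists.1 hT
    refine ⟨a, fun b ↦ ?_⟩
    by_cases hb : b ∈ PSL p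
    · exact .inr ⟨hb, fun h ↦ ha (((PSL p).mul_mem_cancel_left hb).1 h)⟩
    · exact .inl ⟨mul_mem_PSL hb ha, hb⟩
  rw [← Subgroup.relIndex_bot_left,
    ← Subgroup.relIndex_mul_relIndex ⊥ (T ⊓ PSL p) T bot_le inf_le_left,
    Subgroup.inf_relIndex_left, Subgroup.relIndex_bot_left]
  have h2 : (PSL p).relIndex T ≠ 1 := by rwa [ne_eq, Subgroup.relIndex_eq_one]
  rw [((Nat.dvd_prime Nat.prime_two).1 h1).resolve_left h2, mul_comm]

lemma card_le_two_mul_card_inf_PSL (T : Subgroup (PGL 2 p)) :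
    Nat.card T ≤ 2 * Nat.card ↥(T ⊓ PSL p) := by
  by_cases hT : T ≤ PSL p
  · rw [inf_eq_left.2 hT]
    omega
  · exact (card_eq_two_mul_card_inf_PSL hT).le

lemma card_stabilizer_subgroup {G X : Type*} [Group G] [MulAction G X] (M : Subgroup G) (x : X) :
    Nat.card (MulAction.stabilizer M x) = Nat.card ↥(M ⊓ MulAction.stabilizer G x) := by
  refine Nat.card_congr ⟨fun g ↦ ⟨g.1.1, g.1.2, g.2⟩, fun g ↦ ⟨⟨g.1, g.2.1⟩, g.2.2⟩, ?_, ?_⟩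
  · exact fun _ ↦ rfl
  · exact fun _ ↦ rfl

end

section

variable {p : ℕ} [hp : Fact p.Prime]

lemma eq_one_of_pow_char_eq_one {H : Subgroup (PGL 2 p)} (hH : ¬ p ∣ Nat.card H) {g : PGL 2 p}
    (hg : g ∈ H) (h : g ^ p = 1) : g = 1 := by
  have h1 : orderOf (⟨g, hg⟩ : H) ∣ Nat.card H := orderOf_dvd_natCard _
  rw [Subgroup.orderOf_mk] at h1
  rw [← orderOf_eq_one_iff]
  exact ((Nat.dvd_prime hp.out).1 (orderOf_dvd_of_pow_eq_one h)).resolve_right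
    fun h2 ↦ hH (by rwa [h2] at h1)

lemma ncard_fixedBy_of_not_dvd_card [NeZero (2 : ZMod p)] {H : Subgroup (PGL 2 p)}
    (hH : ¬ p ∣ Nat.card H) (g : H) (hg : g ≠ 1) :
    (MulAction.fixedBy (OnePoint (AlgebraicClosure (ZMod p))) g).ncard = 2 :=
  ncard_fixedBy_of_pow_char_ne_one (g := g.1) fun h ↦
    hg (Subtype.ext (eq_one_of_pow_char_eq_one hH g.2 h))

/-- A maximal subgroup of order prime to `p` does not meet the image of `SL(2, p)` in a
tetrahedral group when `2` is a square modulo `p`. -/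
lemma card_inf_PSL_ne_twelve (hp5 : 5 ≤ p) (h2 : IsSquare (2 : ZMod p)) {M : Subgroup (PGL 2 p)}
    (hM : IsCoatom M) (hSM : ¬ PSL p ≤ M) (ho : ∀ g : ↥(M ⊓ PSL p), orderOf g ≤ 3) :
    Nat.card ↥(M ⊓ PSL p) ≠ 12 := by
  intro h12
  obtain ⟨⟨a, haM, haS⟩, ⟨b, hbM, hbS⟩, ha1, hb1, hab1, ha2, hb2, hab2, hV⟩ :=
    exists_klein_of_card_eq_twelve h12 ho
  simp only [Subtype.ext_iff, Subtype.forall, Subgroup.coe_mul, Subgroup.coe_pow,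
    Subgroup.coe_one, ne_eq] at ha1 hb1 hab1 ha2 hb2 hab2 hV
  obtain ⟨w, hwS, hwa, hwb⟩ := exists_sq_eq_of_klein (two_ne_zero_of_five_le hp5) h2 haS hbS
    ha1 hb1 hab1 ha2 hb2 hab2
  have hwa' : w * a = a * w := by rw [← hwa, ← pow_succ, ← pow_succ']
  have hwab : w * (a * b) = b * w := by
    rw [← mul_assoc, hwa', mul_assoc, hwb, ← mul_assoc, ← mul_assoc, ← sq, ha2, one_mul]
  set T : Set (PGL 2 p) := {a, b, a * b} with hT
  have hT' (g : PGL 2 p) : g ∈ T ↔ g ∈ M ⊓ PSL p ∧ g ^ 2 = 1 ∧ g ≠ 1 := by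
    simp only [hT, Set.mem_insert_iff, Set.mem_singleton_iff]
    constructor
    · rintro (rfl | rfl | rfl)
      · exact ⟨⟨haM, haS⟩, ha2, ha1⟩
      · exact ⟨⟨hbM, hbS⟩, hb2, hb1⟩
      · exact ⟨⟨M.mul_mem haM hbM, (PSL p).mul_mem haS hbS⟩, hab2, hab1⟩
    · rintro ⟨hg, hg2, hg1⟩
      exact (hV g hg hg2).resolve_left hg1
  have hTM : T ⊆ M := fun g hg ↦ ((hT' g).1 hg).1.1
  have hMN : M ≤ Subgroup.normalizer T := by
    rw [Subgroup.le_set_normalizer_iff]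
    intro m hm g hg
    obtain ⟨⟨hgM, hgS⟩, hg2, hg1⟩ := (hT' g).1 hg
    refine (hT' _).2 ⟨⟨M.mul_mem (M.mul_mem hm hgM) (M.inv_mem hm),
      Subgroup.Normal.conj_mem inferInstance _ hgS _⟩, ?_, ?_⟩
    · rw [conj_pow, hg2, mul_one, mul_inv_cancel]
    · rwa [ne_eq, conj_eq_one_iff]
  have hwN : w ∈ Subgroup.normalizer T := by
    rw [Subgroup.mem_normalizer_iff_conj_image_eq]
    simp only [hT, Set.image_insert_eq, Set.image_singleton, MulAut.conj_apply, hwa', hwb, hwab,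
      mul_inv_cancel_right]
    rw [Set.pair_comm]
  have hNtop : Subgroup.normalizer T ≠ ⊤ := by
    intro h
    have hN : (Subgroup.closure T).Normal := Subgroup.normalizer_eq_top_iff.1
      (top_le_iff.1 (h ▸ Subgroup.normalizer_le_normalizer_closure T))
    refine hSM ((PSL_le_of_normal hp5 hN fun hbot ↦ ha1 ?_).trans ((Subgroup.closure_le M).2 hTM))
    exact Subgroup.mem_bot.1 (hbot ▸ Subgroup.subset_closure (Set.mem_insert a _))
  have hwM : w ∈ M := by
    rcases hMN.eq_or_lt with h | h
    · exact h ▸ hwN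
    · exact absurd (hM.2 _ h) hNtop
  have hw4 : orderOf w = 2 ^ (1 + 1) := by
    refine orderOf_eq_prime_pow ?_ ?_
    · rwa [pow_one, hwa]
    · rw [pow_succ, pow_one, pow_mul, hwa, ha2]
  have hle := ho ⟨w, hwM, hwS⟩
  rw [← Subgroup.orderOf_coe, hw4] at hle
  norm_num at hle

lemma isSupersolvable_inf_PSL (hp5 : 5 ≤ p) (h2 : IsSquare (2 : ZMod p)) {M : Subgroup (PGL 2 p)}
    (hM : IsCoatom M) (hSM : ¬ PSL p ≤ M) : IsSupersolvable ↥(M ⊓ PSL p) := by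
  have : NeZero (2 : ZMod p) := ⟨two_ne_zero_of_five_le hp5⟩
  by_cases hpM : p ∣ Nat.card M
  · obtain ⟨x, hx⟩ := (PSL_le_or_exists_fixedPoint hpM).resolve_left hSM
    refine isSupersolvable_of_large_stabilizer not_sq_dvd_card x ?_
    have hle : M ⊓ PSL p ≤ MulAction.stabilizer (PGL 2 p) x := fun g hg ↦ hx g hg.1
    rw [card_stabilizer_subgroup, inf_eq_left.2 hle]
    omega
  have hpH : ¬ p ∣ Nat.card ↥(M ⊓ PSL p) := fun h ↦
    hpM (h.trans (Subgroup.card_dvd_of_le inf_le_left))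
  have hMS : ¬ M ≤ PSL p := fun h ↦ by
    rcases h.eq_or_lt with h | h
    · exact hSM h.ge
    · exact PSL_ne_top (by omega) (hM.2 _ h)
  have hcard := card_eq_two_mul_card_inf_PSL hMS
  have hstab (x : OnePoint (AlgebraicClosure (ZMod p))) :
      Nat.card (MulAction.stabilizer M x) ≤ 2 * Nat.card (MulAction.stabilizer ↥(M ⊓ PSL p) x) := by
    rw [card_stabilizer_subgroup, card_stabilizer_subgroup, inf_right_comm]
    exact card_le_two_mul_card_inf_PSL _
  have hY : Nonempty (OnePoint (AlgebraicClosure (ZMod p))) := inferInstance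
  rcases exists_large_stabilizer_or hY (ncard_fixedBy_of_not_dvd_card hpH) with
    ⟨x, hx⟩ | ⟨h12, hs⟩ | ⟨hH, hs⟩
  · exact isSupersolvable_of_large_stabilizer not_sq_dvd_card x hx
  · refine absurd h12 (card_inf_PSL_ne_twelve hp5 h2 hM hSM fun g ↦ ?_)
    by_cases hg : g = 1
    · simp [hg]
    · obtain ⟨x, hx⟩ := Set.nonempty_of_ncard_ne_zero
        (ncard_fixedBy_of_not_dvd_card hpH g hg ▸ two_ne_zero)
      rw [← Subgroup.orderOf_mk g (MulAction.mem_stabilizer_iff.2 hx)]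
      exact orderOf_le_card.trans (hs x)
  · exfalso
    rcases exists_large_stabilizer_or hY (ncard_fixedBy_of_not_dvd_card hpM) with
      ⟨x, hx⟩ | ⟨h12, -⟩ | ⟨hM', -⟩
    · have := hstab x
      have := hs x
      omega
    all_goals omega

end

/-- For a prime `p ≡ ±1 (mod 8)`, every c-section of every maximal subgroup of
`PGL(2,p)` is supersolvable, yet `PGL(2,p)` is not solvable. -/
theorem statement6 (p : ℕ) (hp : p.Prime) (hpm : p % 8 = 1 ∨ p % 8 = 7) :
    (∀ M : Subgroup (PGL 2 p), IsCoatom M →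
      ∀ L K : Subgroup (PGL 2 p), ∀ hcf : IsChiefFactor L K, L ≤ M → ¬K ≤ M →
        haveI : L.Normal := hcf.1
        IsSupersolvable (↥(M ⊓ K) ⧸ L.subgroupOf (M ⊓ K))) ∧
      ¬IsSolvable (PGL 2 p) := by
  have : Fact p.Prime := ⟨hp⟩
  have hp5 : 5 ≤ p := by
    have := hp.two_le
    omega
  have h2 : IsSquare (2 : ZMod p) := (ZMod.exists_sq_eq_two_iff (by omega)).2 hpm
  refine ⟨fun M hM L K hcf hLM hKM ↦ ?_, not_isSolvable_PGL hp5⟩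
  obtain ⟨hL, hK, hLK, hchief⟩ := hcf
  have hSK : PSL p ≤ K := PSL_le_of_normal hp5 hK (ne_bot_of_gt hLK)
  by_cases hLbot : L = ⊥
  · have hKS : K = PSL p := by
      by_contra h
      exact hchief (PSL p) inferInstance (hLbot ▸ bot_lt_iff_ne_bot.2 PSL_ne_bot)
        (lt_of_le_of_ne hSK (Ne.symm h))
    subst hKS
    exact (isSupersolvable_inf_PSL hp5 h2 hM hKM).of_surjective _ (QuotientGroup.mk'_surjective _)
  · have hSL : PSL p ≤ L := PSL_le_of_normal hp5 hL hLbot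
    have hMKL : M ⊓ K ≤ L := by
      rintro g ⟨hgM, -⟩
      by_contra hgL
      refine hKM fun k hk ↦ ?_
      by_contra hkM
      exact hkM ((M.mul_mem_cancel_right hgM).1
        (hLM (hSL (mul_mem_PSL (fun h ↦ hkM (hLM (hSL h))) fun h ↦ hgL (hSL h)))))
    have : Subsingleton (↥(M ⊓ K) ⧸ L.subgroupOf (M ⊓ K)) :=
      QuotientGroup.subsingleton_iff.2 (Subgroup.subgroupOf_eq_top.2 hMKL)
    exact isSupersolvable_of_subsingleton
end

section
/- There exists a finite non-solvable group G such that for every maximal subgroup M of G, every c-section of M is supersolvable. (For example G = PGL(2,7).) -/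
namespace IsSupersolvable

theorem of_surjective_s7 {G H : Type*} [Group G] [Group H] (φ : G →* H)
    (hφ : Function.Surjective φ) (h : IsSupersolvable G) : IsSupersolvable H := by
  obtain ⟨n, f, hmono, h0, hlast, hnorm, hcyc⟩ := h
  refine ⟨n, fun i => (f i).map φ, fun i j hij => Subgroup.map_mono (hmono hij), ?_, ?_, ?_, ?_⟩
  · simp [h0]
  · simpa [hlast, ← MonoidHom.range_eq_map] using MonoidHom.range_eq_top.2 hφ
  · exact fun i => (hnorm i).map φ hφ
  · intro i
    obtain ⟨x, hx, hle⟩ := hcyc i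
    refine ⟨φ x, Subgroup.mem_map_of_mem φ hx, ?_⟩
    rw [← MonoidHom.map_zpowers, ← Subgroup.map_sup]
    exact Subgroup.map_mono hle

theorem of_isCyclic (G : Type*) [Group G] [IsCyclic G] : IsSupersolvable G := by
  obtain ⟨x, hx⟩ := IsCyclic.exists_generator (α := G)
  refine ⟨1, ![⊥, ⊤], ?_, rfl, rfl, ?_, ?_⟩
  · refine Fin.monotone_iff_le_succ.2 fun i => ?_
    fin_cases i
    exact bot_le
  · intro i
    fin_cases i
    · exact (inferInstance : (⊥ : Subgroup G).Normal)
    · exact (inferInstance : (⊤ : Subgroup G).Normal)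
  · intro i
    fin_cases i
    exact ⟨x, Subgroup.mem_top x, fun g _ => Subgroup.mem_sup_right (hx g)⟩

theorem of_quotient_zpowers {G : Type*} [Group G] (x : G) [(Subgroup.zpowers x).Normal]
    (h : IsSupersolvable (G ⧸ Subgroup.zpowers x)) : IsSupersolvable G := by
  obtain ⟨n, f, hmono, h0, hlast, hnorm, hcyc⟩ := h
  have hker : ∀ i, Subgroup.zpowers x ≤ (f i).comap (QuotientGroup.mk' (Subgroup.zpowers x)) := by
    intro i
    conv_lhs => rw [← QuotientGroup.ker_mk' (Subgroup.zpowers x)]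
    exact MonoidHom.ker_le_comap _ _
  refine ⟨n + 1, Fin.cons ⊥ fun i => (f i).comap (QuotientGroup.mk' (Subgroup.zpowers x)),
    ?_, rfl, ?_, ?_, ?_⟩
  · refine Fin.monotone_iff_le_succ.2 fun i => ?_
    refine Fin.cases ?_ (fun j => ?_) i
    · exact bot_le
    · rw [← Fin.succ_castSucc, Fin.cons_succ, Fin.cons_succ]
      exact Subgroup.comap_mono (hmono (Fin.castSucc_lt_succ).le)
  · rw [← Fin.succ_last, Fin.cons_succ, hlast, Subgroup.comap_top]
  · intro i
    refine Fin.cases ?_ (fun j => ?_) i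
    · exact (inferInstance : (⊥ : Subgroup G).Normal)
    · rw [Fin.cons_succ]
      exact (hnorm j).comap _
  · intro i
    refine Fin.cases ?_ (fun j => ?_) i
    · refine ⟨x, ?_, ?_⟩
      · rw [Fin.cons_succ]
        exact hker 0 (Subgroup.mem_zpowers x)
      · rw [Fin.cons_succ, h0, MonoidHom.comap_bot, QuotientGroup.ker_mk']
        exact le_sup_right
    · obtain ⟨y, hy, hle⟩ := hcyc j
      obtain ⟨y, rfl⟩ := QuotientGroup.mk'_surjective (Subgroup.zpowers x) y
      refine ⟨y, by rw [Fin.cons_succ]; exact hy, ?_⟩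
      rw [← Fin.succ_castSucc, Fin.cons_succ, Fin.cons_succ]
      refine (Subgroup.comap_mono hle).trans ?_
      rw [← MonoidHom.map_zpowers,
        ← Subgroup.comap_sup_eq _ _ _ (QuotientGroup.mk'_surjective _), Subgroup.comap_map_eq,
        QuotientGroup.ker_mk']
      exact sup_le le_sup_left (sup_le le_sup_right ((hker _).trans le_sup_left))

theorem of_isPGroup {p : ℕ} [Fact p.Prime] {G : Type*} [Group G] [Finite G]
    (hG : IsPGroup p G) : IsSupersolvable G := by
  induction hn : Nat.card G using Nat.strong_induction_on generalizing G with
  | _ n ih =>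
    rcases subsingleton_or_nontrivial G with _ | _
    · exact of_isCyclic G
    · have := hG.center_nontrivial
      obtain ⟨⟨z, hz⟩, hz1⟩ := exists_ne (1 : Subgroup.center G)
      have hle : Subgroup.zpowers z ≤ Subgroup.center G := by
        simpa [Subgroup.zpowers_le] using hz
      have : (Subgroup.zpowers z).Normal := ⟨fun y hy g => by
        rwa [Subgroup.mem_center_iff.1 (hle hy) g, mul_inv_cancel_right]⟩
      refine of_quotient_zpowers z (ih _ ?_ (hG.to_quotient _) rfl)
      have hz1' : z ≠ 1 := fun h => hz1 (Subtype.ext h)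
      have : Nontrivial (Subgroup.zpowers z) :=
        (Subgroup.nontrivial_iff_ne_bot _).2 (by simpa using hz1')
      have h2 : 1 < Nat.card (Subgroup.zpowers z) := Finite.one_lt_card
      rw [← hn, Subgroup.card_eq_card_quotient_mul_card_subgroup (Subgroup.zpowers z)]
      exact lt_mul_of_one_lt_right Nat.card_pos h2

theorem of_self_centralizing {G : Type*} [Group G] {x : G} (hp : (orderOf x).Prime)
    (hnorm : ∀ g, g * x * g⁻¹ ∈ Subgroup.zpowers x)
    (hcent : ∀ g, g * x = x * g → g ∈ Subgroup.zpowers x) : IsSupersolvable G := by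
  have hN : (Subgroup.zpowers x).Normal := by
    refine ⟨fun y hy g => ?_⟩
    obtain ⟨k, rfl⟩ := Subgroup.mem_zpowers_iff.1 hy
    rw [← conj_zpow]
    exact Subgroup.zpow_mem _ (hnorm g) k
  let φ : G →* MulAut (Subgroup.zpowers x) := MulAut.conjNormal
  have hker : φ.ker = Subgroup.zpowers x := by
    ext g
    constructor
    · intro hg
      have h1 := congrArg (fun ψ : MulAut (Subgroup.zpowers x) =>
        ((ψ ⟨x, Subgroup.mem_zpowers x⟩ : Subgroup.zpowers x) : G)) (MonoidHom.mem_ker.1 hg)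
      simp only [φ, MulAut.conjNormal_apply, MulAut.one_apply] at h1
      exact hcent g (mul_inv_eq_iff_eq_mul.1 h1)
    · intro hg
      obtain ⟨k, rfl⟩ := Subgroup.mem_zpowers_iff.1 hg
      refine MonoidHom.mem_ker.2 (MulEquiv.ext fun y => Subtype.ext ?_)
      obtain ⟨m, hm⟩ := Subgroup.mem_zpowers_iff.1 y.2
      simp only [φ, MulAut.conjNormal_apply, MulAut.one_apply, ← hm]
      group
  have : Fact (Nat.card (Subgroup.zpowers x)).Prime := ⟨by rwa [Nat.card_zpowers]⟩
  have : IsCyclic (MulAut (Subgroup.zpowers x)) :=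
    isCyclic_of_surjective (IsCyclic.mulAutMulEquiv (Subgroup.zpowers x)).symm
      (MulEquiv.surjective _)
  have : IsCyclic (G ⧸ φ.ker) :=
    isCyclic_of_injective (QuotientGroup.kerLift φ) (QuotientGroup.kerLift_injective φ)
  refine of_quotient_zpowers x (of_surjective_s7
    (QuotientGroup.quotientMulEquivOfEq hker).toMonoidHom (MulEquiv.surjective _)
    (of_isCyclic _))

end IsSupersolvable

namespace ProjectiveLine

open Equiv

/-- The translation `x ↦ x + 1` of the projective line over `𝔽₇`, with `7` standing for `∞`. -/
def translation : Perm (Fin 8) :=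
  ⟨![1, 2, 3, 4, 5, 6, 0, 7], ![6, 0, 1, 2, 3, 4, 5, 7], by decide, by decide⟩

/-- The dilation `x ↦ 3 * x`. -/
def dilation : Perm (Fin 8) :=
  ⟨![0, 3, 6, 2, 5, 1, 4, 7], ![0, 5, 3, 1, 6, 4, 2, 7], by decide, by decide⟩

/-- The involution `x ↦ -1 / x`. -/
def inversion : Perm (Fin 8) :=
  ⟨![7, 6, 3, 2, 5, 4, 1, 0], ![7, 6, 3, 2, 5, 4, 1, 0], by decide, by decide⟩

/-- `PGL(2,7)` as a permutation group of the projective line over `𝔽₇`. -/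
abbrev PGL27 : Type := Subgroup.closure ({translation, dilation, inversion} : Set (Perm (Fin 8)))

namespace PGL27

/-- The translation `x ↦ x + 1`. -/
def c : PGL27 := ⟨translation, Subgroup.subset_closure (by simp)⟩

/-- The dilation `x ↦ 3 * x`. -/
def t : PGL27 := ⟨dilation, Subgroup.subset_closure (by simp)⟩

/-- The involution `x ↦ -1 / x`. -/
def w : PGL27 := ⟨inversion, Subgroup.subset_closure (by simp)⟩

/-! ### Permutations of `Fin 8` as octal numerals -/

/-- The `i`-th octal digit, written without type classes for the sake of kernel evaluation. -/
def digit (n i : ℕ) : ℕ := Nat.mod (Nat.div n (Nat.pow 8 i)) 8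

theorem digit_eq (n i : ℕ) : digit n i = n / 8 ^ i % 8 := rfl

/-- The numeral whose digits are the values of a permutation. -/
def code (g : PGL27) : ℕ := ∑ i : Fin 8, (g.1 i : ℕ) * 8 ^ (i : ℕ)

/-- The codes of the composition of the permutations with codes `m` and `n`. -/
def codeMul (m n : ℕ) : ℕ :=
  let d (i : ℕ) (r : ℕ) : ℕ := Nat.add (digit m (digit n i)) (Nat.mul 8 r)
  d 0 (d 1 (d 2 (d 3 (d 4 (d 5 (d 6 (d 7 0)))))))

theorem codeMul_eq (m n : ℕ) : codeMul m n =
    digit m (digit n 0) + digit m (digit n 1) * 8 + digit m (digit n 2) * 64 +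
      digit m (digit n 3) * 512 + digit m (digit n 4) * 4096 + digit m (digit n 5) * 32768 +
      digit m (digit n 6) * 262144 + digit m (digit n 7) * 2097152 := by
  simp only [codeMul, Nat.add_eq, Nat.mul_eq]
  ring

/-- Inversion on codes. -/
def codeInv (n : ℕ) : ℕ :=
  8 ^ digit n 1 + 2 * 8 ^ digit n 2 + 3 * 8 ^ digit n 3 + 4 * 8 ^ digit n 4 +
    5 * 8 ^ digit n 5 + 6 * 8 ^ digit n 6 + 7 * 8 ^ digit n 7

theorem digit_code (g : PGL27) (i : Fin 8) : digit (code g) i = g.1 i := by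
  have h0 := (g.1 0).isLt
  have h1 := (g.1 1).isLt
  have h2 := (g.1 2).isLt
  have h3 := (g.1 3).isLt
  have h4 := (g.1 4).isLt
  have h5 := (g.1 5).isLt
  have h6 := (g.1 6).isLt
  have h7 := (g.1 7).isLt
  fin_cases i <;> simp [digit_eq, code, Fin.sum_univ_eight] <;> omega

theorem code_injective : Function.Injective code := by
  intro g h hgh
  refine Subtype.ext (Equiv.ext fun i => Fin.ext ?_)
  rw [← digit_code, ← digit_code, hgh]

theorem code_mul (g h : PGL27) : code (g * h) = codeMul (code g) (code h) := by
  have key (i : Fin 8) : digit (code g) (digit (code h) i) = (g * h).1 i := by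
    rw [digit_code, digit_code]
    rfl
  have e := Fin.sum_univ_eight fun i : Fin 8 => ((g * h).1 i : ℕ) * 8 ^ (i : ℕ)
  simp only [← key] at e
  rw [code]
  simp only [← key]
  rw [e]
  norm_num [codeMul_eq]

theorem code_inv (g : PGL27) : code g⁻¹ = codeInv (code g) := by
  have h : code g⁻¹ = ∑ i : Fin 8, (i : ℕ) * 8 ^ digit (code g) i := by
    rw [code, ← Equiv.sum_comp g.1]
    refine Finset.sum_congr rfl fun i _ => ?_
    rw [digit_code, Subgroup.coe_inv]
    exact congrArg (fun j : Fin 8 => (j : ℕ) * 8 ^ (g.1 i : ℕ)) (g.1.symm_apply_apply i)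
  rw [h, Fin.sum_univ_eight]
  norm_num [codeInv]

/-- Powers on codes. -/
def codePow (m : ℕ) : ℕ → ℕ
  | 0 => 16434824
  | n + 1 => codeMul (codePow m n) m

theorem code_one : code 1 = 16434824 := by decide

theorem code_pow (g : PGL27) (n : ℕ) : code (g ^ n) = codePow (code g) n := by
  induction n with
  | zero => exact code_one
  | succ n ih => rw [pow_succ, code_mul, ih, codePow]

theorem code_c : code c = 14899409 := by decide

theorem code_t : code t = 15783320 := by decide

theorem code_w : code w = 414967 := by decide

/-! ### Bruhat normal form -/

/-- Codes of the elements `c ^ i * t ^ j` and `c ^ i * t ^ j * w * c ^ k` for `j` in `js`. -/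
def codes (js : List ℕ) : List ℕ :=
  (List.range 7).flatMap fun i => js.flatMap fun j =>
    codeMul (codePow 14899409 i) (codePow 15783320 j) :: (List.range 7).map fun k =>
      codeMul (codeMul (codeMul (codePow 14899409 i) (codePow 15783320 j)) 414967)
        (codePow 14899409 k)

theorem mem_codes {js : List ℕ} {n : ℕ} : n ∈ codes js ↔
    ∃ i < 7, ∃ j ∈ js, n = code (c ^ i * t ^ j) ∨ ∃ k < 7, n = code (c ^ i * t ^ j * w * c ^ k) := by
  simp only [codes, List.mem_flatMap, List.mem_range, List.mem_cons, List.mem_map, code_mul,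
    code_pow, code_c, code_t, code_w, eq_comm (a := n)]

theorem codes_closed : ((codes (List.range 6)).all fun n =>
    [14899409, 15783320, 414967].all fun s => (List.range 6).any fun j =>
      codeMul s n == codeMul (codePow 14899409 (digit (codeMul s n) 0 % 7)) (codePow 15783320 j) ||
      codeMul s n == codeMul (codeMul (codeMul (codePow 14899409 (digit (codeMul s n) 7 % 7))
        (codePow 15783320 j)) 414967)
        (codePow 14899409 ((7 - digit (codeInv (codeMul s n)) 7) % 7))) = true := by
  decide +kernel

theorem code_mem (g : PGL27) : code g ∈ codes (List.range 6) := by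
  obtain ⟨x, hx⟩ := g
  have hx' := hx
  rw [← Subgroup.mem_toSubmonoid, Subgroup.closure_toSubmonoid_of_finite] at hx'
  induction hx' using Submonoid.closure_induction_left with
  | one => exact mem_codes.2 ⟨0, by simp, 0, by simp, Or.inl (by simp; rfl)⟩
  | mul_left s hs y hy ih =>
    have hs' := Subgroup.subset_closure hs
    have hy' : y ∈ Subgroup.closure _ := (Subgroup.mul_mem_cancel_left _ hs').1 hx
    have key := List.all_eq_true.1 codes_closed _ (ih hy')
    have hsc : code ⟨s, hs'⟩ ∈ [14899409, 15783320, 414967] := by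
      rw [← code_c, ← code_t, ← code_w]
      rcases hs with rfl | rfl | rfl
      · exact List.mem_cons_self
      · exact List.mem_cons_of_mem _ List.mem_cons_self
      · exact List.mem_cons_of_mem _ (List.mem_cons_of_mem _ List.mem_cons_self)
    obtain ⟨j, hj, h⟩ := List.any_eq_true.1 (List.all_eq_true.1 key _ hsc)
    simp only [← code_mul, ← code_inv, ← code_c, ← code_t, ← code_w, ← code_pow, Bool.or_eq_true,
      beq_iff_eq] at h
    have lt (n : ℕ) : n % 7 < 7 := Nat.mod_lt _ (by decide)
    obtain h | h := h
    · exact mem_codes.2 ⟨_, lt _, j, hj, Or.inl h⟩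
    · exact mem_codes.2 ⟨_, lt _, j, hj, Or.inr ⟨_, lt _, h⟩⟩

theorem exists_of_mem_codes {js : List ℕ} {n : ℕ} (h : n ∈ codes js) : ∃ g, code g = n := by
  obtain ⟨i, -, j, -, h | ⟨k, -, h⟩⟩ := mem_codes.1 h
  exacts [⟨_, h.symm⟩, ⟨_, h.symm⟩]

/-! ### The subgroup of even elements, isomorphic to `PSL(2,7)` -/

/-- The sign character. -/
def sgn : PGL27 →* ℤˣ := Perm.sign.comp (Subgroup.subtype _)

/-- The subgroup `PSL(2,7)` of even elements. -/
def S : Subgroup PGL27 := sgn.ker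

instance : S.Normal := MonoidHom.normal_ker _

theorem sgn_c : sgn c = 1 := by decide

theorem sgn_t : sgn t = -1 := by decide

theorem sgn_w : sgn w = 1 := by decide

theorem code_mem_of_sgn {js : List ℕ} {g : PGL27}
    (hjs : ∀ j < 6, (-1 : ℤˣ) ^ j = sgn g → j ∈ js) : code g ∈ codes js := by
  obtain ⟨i, hi, j, hj, h⟩ := mem_codes.1 (code_mem g)
  refine mem_codes.2 ⟨i, hi, j, hjs j (List.mem_range.1 hj) ?_, h⟩
  obtain h | ⟨k, -, h⟩ := h <;>
    simp [code_injective h, sgn_c, sgn_t, sgn_w]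

theorem code_mem_of_mem_S {g : PGL27} (hg : g ∈ S) : code g ∈ codes [0, 2, 4] := by
  refine code_mem_of_sgn ?_
  rw [show sgn g = 1 from hg]
  decide

theorem code_mem_of_notMem_S {g : PGL27} (hg : g ∉ S) : code g ∈ codes [1, 3, 5] := by
  refine code_mem_of_sgn ?_
  rw [(Int.units_eq_one_or (sgn g)).resolve_left hg]
  decide

theorem mul_inv_mem_S {g h : PGL27} (hg : g ∉ S) (hh : h ∉ S) : g * h⁻¹ ∈ S := by
  have h1 := (Int.units_eq_one_or (sgn g)).resolve_left hg
  have h2 := (Int.units_eq_one_or (sgn h)).resolve_left hh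
  show sgn (g * h⁻¹) = 1
  rw [map_mul, map_inv, h1, h2, mul_inv_cancel]

/-- The unipotent element fixing `0`. -/
def l : PGL27 := w * c * w⁻¹

theorem code_l : code l = 13505912 := by decide

theorem code_a : code (t ^ 2) = codePow 15783320 2 := by rw [code_pow, code_t]

theorem S_le_of_mem {H : Subgroup PGL27} (hc : c ∈ H) (hl : l ∈ H) : S ≤ H := by
  have hw : w ∈ H := by
    have : w = c * l * c := code_injective (by decide)
    rw [this]
    exact H.mul_mem (H.mul_mem hc hl) hc
  have ha : t ^ 2 ∈ H := by
    have : t ^ 2 = c * l ^ 4 * c ^ 5 * l ^ 5 := code_injective (by decide +kernel)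
    rw [this]
    exact H.mul_mem (H.mul_mem (H.mul_mem hc (H.pow_mem hl 4)) (H.pow_mem hc 5)) (H.pow_mem hl 5)
  intro g hg
  obtain ⟨i, -, j, hj, h⟩ := mem_codes.1 (code_mem_of_mem_S hg)
  have htj : t ^ j ∈ H := by
    obtain ⟨k, rfl⟩ : 2 ∣ j := by
      clear h
      revert j
      decide
    rw [pow_mul]
    exact H.pow_mem ha k
  have hct := H.mul_mem (H.pow_mem hc i) htj
  obtain h | ⟨k, -, h⟩ := h
  · rwa [code_injective h]
  · rw [code_injective h]
    exact H.mul_mem (H.mul_mem hct hw) (H.pow_mem hc k)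

/-! ### Finite verifications -/

theorem exists_conj_c {e : PGL27} (h7 : e ^ 7 = 1) (h1 : e ≠ 1) : ∃ h, h * c = e * h := by
  have key : ((codes (List.range 6)).all fun e => codePow e 7 != 16434824 || (e == 16434824 ||
      (codes (List.range 6)).any fun h => codeMul h 14899409 == codeMul e h)) = true := by
    decide +kernel
  have := List.all_eq_true.1 key _ (code_mem e)
  rw [← code_pow, h7, ← code_one] at this
  simp only [bne_self_eq_false, Bool.false_or, Bool.or_eq_true, beq_iff_eq,
    code_injective.eq_iff, h1, false_or] at this
  obtain ⟨n, hn, h⟩ := List.any_eq_true.1 this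
  obtain ⟨h', rfl⟩ := exists_of_mem_codes hn
  rw [← code_c, ← code_mul, ← code_mul, beq_iff_eq, code_injective.eq_iff] at h
  exact ⟨h', h⟩

theorem exists_conj_t_sq {e : PGL27} (h3 : e ^ 3 = 1) (h1 : e ≠ 1) :
    ∃ h, h * t ^ 2 = e * h := by
  have key : ((codes (List.range 6)).all fun e => codePow e 3 != 16434824 || (e == 16434824 ||
      (codes (List.range 6)).any fun h =>
        codeMul h (codePow 15783320 2) == codeMul e h)) = true := by
    decide +kernel
  have := List.all_eq_true.1 key _ (code_mem e)
  rw [← code_pow, h3, ← code_one] at this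
  simp only [bne_self_eq_false, Bool.false_or, Bool.or_eq_true, beq_iff_eq,
    code_injective.eq_iff, h1, false_or] at this
  obtain ⟨n, hn, h⟩ := List.any_eq_true.1 this
  obtain ⟨h', rfl⟩ := exists_of_mem_codes hn
  rw [← code_a, ← code_mul, ← code_mul, beq_iff_eq, code_injective.eq_iff] at h
  exact ⟨h', h⟩

theorem exists_commutator_order_three {g : PGL27} (h1 : g ≠ 1) :
    ∃ x, (g * x * g⁻¹ * x⁻¹) ^ 3 = 1 ∧ g * x * g⁻¹ * x⁻¹ ≠ 1 := by
  have key : ((codes (List.range 6)).all fun g => g == 16434824 ||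
      (codes (List.range 6)).any fun x =>
        codePow (codeMul (codeMul (codeMul g x) (codeInv g)) (codeInv x)) 3 == 16434824 &&
        codeMul (codeMul (codeMul g x) (codeInv g)) (codeInv x) != 16434824) = true := by
    decide +kernel
  have := List.all_eq_true.1 key _ (code_mem g)
  rw [← code_one] at this
  simp only [Bool.or_eq_true, beq_iff_eq, code_injective.eq_iff, h1, false_or] at this
  obtain ⟨n, hn, h⟩ := List.any_eq_true.1 this
  obtain ⟨x, rfl⟩ := exists_of_mem_codes hn
  simp only [← code_mul, ← code_inv, ← code_pow, Bool.and_eq_true, beq_iff_eq, bne_iff_ne,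
    ne_eq, code_injective.eq_iff] at h
  exact ⟨x, h⟩

theorem conj_c (b : PGL27) : (∃ j, b * c = c ^ j * b) ∨
    ∃ i j, b * c ^ j * b⁻¹ * c ^ i = c ^ i * l := by
  have key : ((codes (List.range 6)).all fun b =>
      ((List.range 7).any fun j => codeMul b 14899409 == codeMul (codePow 14899409 j) b) ||
      (List.range 7).any fun i => (List.range 7).any fun j =>
        codeMul (codeMul (codeMul b (codePow 14899409 j)) (codeInv b)) (codePow 14899409 i) ==
          codeMul (codePow 14899409 i) 13505912) = true := by
    decide +kernel
  have := List.all_eq_true.1 key _ (code_mem b)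
  simp only [← code_c, ← code_l, ← code_mul, ← code_inv, ← code_pow, Bool.or_eq_true,
    List.any_eq_true, beq_iff_eq, code_injective.eq_iff] at this
  obtain ⟨j, -, h⟩ | ⟨i, -, j, -, h⟩ := this
  exacts [Or.inl ⟨j, h⟩, Or.inr ⟨i, j, h⟩]

theorem mem_zpowers_c {s : PGL27} (hs : s * c = c * s) : s ∈ Subgroup.zpowers c := by
  have key : ((codes (List.range 6)).all fun s =>
      codeMul s 14899409 != codeMul 14899409 s ||
        (List.range 7).any fun i => s == codePow 14899409 i) = true := by
    decide +kernel
  have := List.all_eq_true.1 key _ (code_mem s)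
  simp only [← code_c, ← code_mul, ← code_pow, hs, bne_self_eq_false, Bool.false_or,
    List.any_eq_true, beq_iff_eq, code_injective.eq_iff] at this
  obtain ⟨i, -, rfl⟩ := this
  exact Subgroup.npow_mem_zpowers c i

theorem mem_zpowers_t_sq {s : PGL27} (hS : s ∈ S) (hs : s * t ^ 2 = t ^ 2 * s) :
    s ∈ Subgroup.zpowers (t ^ 2) := by
  have key : ((codes [0, 2, 4]).all fun s =>
      codeMul s (codePow 15783320 2) != codeMul (codePow 15783320 2) s ||
        (List.range 3).any fun i => s == codePow (codePow 15783320 2) i) = true := by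
    decide +kernel
  have := List.all_eq_true.1 key _ (code_mem_of_mem_S hS)
  simp only [← code_a, ← code_mul, ← code_pow, hs, bne_self_eq_false, Bool.false_or,
    List.any_eq_true, beq_iff_eq, code_injective.eq_iff] at this
  obtain ⟨i, -, rfl⟩ := this
  exact Subgroup.npow_mem_zpowers _ i

theorem pow_eight_or_six_or_seven (g : PGL27) : g ^ 8 = 1 ∨ g ^ 6 = 1 ∨ g ^ 7 = 1 := by
  have key : ((codes (List.range 6)).all fun g => codePow g 8 == 16434824 ||
      (codePow g 6 == 16434824 || codePow g 7 == 16434824)) = true := by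
    decide +kernel
  have := List.all_eq_true.1 key _ (code_mem g)
  simpa only [← code_one, ← code_pow, Bool.or_eq_true, beq_iff_eq,
    code_injective.eq_iff] using this

theorem conj_t_sq {b : PGL27} (hb : b ∉ S) :
    b * t ^ 2 = t ^ 2 * b ∨ b * t ^ 2 = (t ^ 2) ^ 2 * b ∨
      ∃ e ∈ Subgroup.closure {t ^ 2, b}, e ^ 7 = 1 ∧ e ≠ 1 := by
  have key : ((codes [1, 3, 5]).all fun b =>
      codeMul b (codePow 15783320 2) == codeMul (codePow 15783320 2) b ||
      (codeMul b (codePow 15783320 2) == codeMul (codePow (codePow 15783320 2) 2) b ||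
      [[(2, 1), (1, 5)], [(2, 2), (1, 4)], [(2, 1), (1, 1), (1, 4)], [(2, 2)],
        [(2, 1), (2, 1), (1, 1), (1, 1)]].any fun u =>
          codePow (u.foldr (fun p n => codeMul (codeMul (codePow (codePow 15783320 2) p.1)
            (codePow b p.2)) n) 16434824) 7 == 16434824 &&
          u.foldr (fun p n => codeMul (codeMul (codePow (codePow 15783320 2) p.1)
            (codePow b p.2)) n) 16434824 != 16434824)) = true := by
    decide +kernel
  have word (u : List (ℕ × ℕ)) : ∃ e ∈ Subgroup.closure {t ^ 2, b},
      u.foldr (fun p n => codeMul (codeMul (codePow (code (t ^ 2)) p.1)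
        (codePow (code b) p.2)) n) (code 1) = code e := by
    induction u with
    | nil => exact ⟨1, one_mem _, rfl⟩
    | cons p u ih =>
      obtain ⟨e, he, hu⟩ := ih
      refine ⟨(t ^ 2) ^ p.1 * b ^ p.2 * e, mul_mem (mul_mem
        (pow_mem (Subgroup.subset_closure (by simp)) _)
        (pow_mem (Subgroup.subset_closure (by simp)) _)) he, ?_⟩
      rw [List.foldr_cons, hu, code_mul, code_mul, code_pow (t ^ 2), code_pow b]
  have := List.all_eq_true.1 key _ (code_mem_of_notMem_S hb)
  rw [← code_a, ← code_one] at this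
  simp only [Bool.or_eq_true, beq_iff_eq] at this
  obtain h | h | h := this
  · rw [← code_mul, ← code_mul, code_injective.eq_iff] at h
    exact Or.inl h
  · rw [← code_pow, ← code_mul, ← code_mul, code_injective.eq_iff] at h
    exact Or.inr (Or.inl h)
  · obtain ⟨u, -, h⟩ := List.any_eq_true.1 h
    obtain ⟨e, he, hu⟩ := word u
    rw [hu] at h
    simp only [← code_pow, Bool.and_eq_true, beq_iff_eq, bne_iff_ne, ne_eq,
      code_injective.eq_iff] at h
    exact Or.inr (Or.inr ⟨e, he, h⟩)


/-! ### Normal subgroups and solvability -/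

theorem l_mem {N : Subgroup PGL27} [hN : N.Normal] (hc : c ∈ N) : l ∈ N :=
  hN.conj_mem c hc w

theorem S_le_of_normal {N : Subgroup PGL27} [hN : N.Normal] (h : N ≠ ⊥) : S ≤ N := by
  obtain ⟨g, hg, hg1⟩ := N.bot_or_exists_ne_one.resolve_left h
  obtain ⟨x, hx3, hx1⟩ := exists_commutator_order_three hg1
  have hk : g * x * g⁻¹ * x⁻¹ ∈ N := by
    have := N.mul_mem hg (hN.conj_mem _ (N.inv_mem hg) x)
    simpa only [mul_assoc] using this
  obtain ⟨y, hy⟩ := exists_conj_t_sq hx3 hx1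
  have ha : t ^ 2 ∈ N := by
    have := hN.conj_mem _ hk y⁻¹
    rwa [inv_inv, mul_assoc, ← hy, inv_mul_cancel_left] at this
  have hc : c ∈ N := by
    have h1 := N.mul_mem ha (hN.conj_mem _ (N.inv_mem ha) c)
    have h2 : t ^ 2 * (c * (t ^ 2)⁻¹ * c⁻¹) = c := code_injective (by decide +kernel)
    rwa [h2] at h1
  exact S_le_of_mem hc (l_mem hc)

theorem c_mem_S : c ∈ S := sgn_c

theorem S_ne_bot : S ≠ ⊥ := by
  intro h
  have h1 : c ∈ (⊥ : Subgroup PGL27) := h ▸ c_mem_S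
  exact absurd (congrArg code (Subgroup.mem_bot.1 h1)) (by decide)

theorem S_ne_top : S ≠ ⊤ := by
  intro h
  have h1 : sgn t = 1 := (h ▸ Subgroup.mem_top t : t ∈ S)
  rw [sgn_t] at h1
  exact absurd h1 (by decide)

theorem not_isSolvable : ¬Group.IsSolvable PGL27 := by
  intro hsol
  refine (Group.IsSolvable.commutator_lt_of_ne_bot S_ne_bot).not_ge (S_le_of_normal fun h => ?_)
  have h1 : c * l * c⁻¹ * l⁻¹ ∈ (⊥ : Subgroup PGL27) :=
    h ▸ Subgroup.commutator_mem_commutator c_mem_S (l_mem c_mem_S)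
  have h2 : code (c * l) = code (l * c) :=
    congrArg code (mul_inv_eq_iff_eq_mul.1 (mul_inv_eq_one.1 (Subgroup.mem_bot.1 h1)))
  rw [code_mul, code_mul, code_c, code_l] at h2
  exact absurd h2 (by decide)

/-! ### Intersections of subgroups with `PSL(2,7)` -/

theorem isSupersolvable_inf_S_of_conj {M : Subgroup PGL27} (h : PGL27)
    (hM : IsSupersolvable ↥(M.comap (MulAut.conj h).toMonoidHom ⊓ S)) :
    IsSupersolvable ↥(M ⊓ S) := by
  have hS : S.comap (MulAut.conj h).toMonoidHom = S := by
    ext g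
    show h * g * h⁻¹ ∈ S ↔ g ∈ S
    rw [Subgroup.Normal.mem_comm_iff inferInstance, inv_mul_cancel_left]
  have e : M.comap (MulAut.conj h).toMonoidHom ⊓ S =
      (M ⊓ S).comap (MulAut.conj h).toMonoidHom := by
    rw [Subgroup.comap_inf, hS]
  rw [e] at hM
  exact hM.of_surjective_s7 _ (MonoidHom.subgroupComap_surjective_of_surjective
    (MulAut.conj h).toMonoidHom (M ⊓ S) (MulAut.conj h).surjective)

theorem isSupersolvable_inf_S_of_mem {M : Subgroup PGL27} {x : PGL27} (hxM : x ∈ M)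
    (hxS : x ∈ S) (hp : (orderOf x).Prime) (hnorm : ∀ g ∈ M, g * x * g⁻¹ ∈ Subgroup.zpowers x)
    (hcent : ∀ g ∈ S, g * x = x * g → g ∈ Subgroup.zpowers x) : IsSupersolvable ↥(M ⊓ S) := by
  have mem (g : ↥(M ⊓ S)) (hg : (g : PGL27) ∈ Subgroup.zpowers x) :
      g ∈ Subgroup.zpowers (⟨x, hxM, hxS⟩ : ↥(M ⊓ S)) := by
    obtain ⟨k, hk⟩ := Subgroup.mem_zpowers_iff.1 hg
    exact Subgroup.mem_zpowers_iff.2 ⟨k, Subtype.ext hk⟩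
  refine IsSupersolvable.of_self_centralizing (x := ⟨x, hxM, hxS⟩)
    (by rwa [← Subgroup.orderOf_coe]) (fun g => mem _ (hnorm g g.2.1))
    fun g hg => mem _ (hcent g g.2.2 (congrArg Subtype.val hg))

theorem isSupersolvable_inf_S_of_c_mem {M : Subgroup PGL27} (hS : ¬S ≤ M) (hc : c ∈ M) :
    IsSupersolvable ↥(M ⊓ S) := by
  refine isSupersolvable_inf_S_of_mem hc c_mem_S ?_ (fun g hg => ?_) fun g _ => mem_zpowers_c
  · have : Fact (Nat.Prime 7) := ⟨by decide⟩
    have : orderOf c = 7 := orderOf_eq_prime (code_injective (by decide +kernel))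
      fun h => absurd (congrArg code h) (by decide)
    rw [this]
    decide
  · obtain ⟨j, hj⟩ | ⟨i, j, h⟩ := conj_c g
    · rw [hj, mul_inv_cancel_right]
      exact Subgroup.npow_mem_zpowers c j
    · refine absurd (S_le_of_mem hc ?_) hS
      rw [← inv_mul_eq_iff_eq_mul] at h
      rw [← h]
      exact mul_mem (inv_mem (pow_mem hc i)) (mul_mem (mul_mem (mul_mem hg (pow_mem hc j))
        (inv_mem hg)) (pow_mem hc i))

theorem isSupersolvable_inf_S_of_t_sq_mem {M : Subgroup PGL27} (hS : ¬M ≤ S)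
    (h7 : ∀ e ∈ M, e ^ 7 = 1 → e = 1) (ha : t ^ 2 ∈ M) : IsSupersolvable ↥(M ⊓ S) := by
  have haS : t ^ 2 ∈ S := by
    show sgn (t ^ 2) = 1
    rw [map_pow, sgn_t]
    decide
  have odd (b : PGL27) (hb : b ∈ M) (hbS : b ∉ S) (x : PGL27)
      (hx : x ∈ Subgroup.zpowers (t ^ 2)) : b * x * b⁻¹ ∈ Subgroup.zpowers (t ^ 2) := by
    obtain ⟨k, rfl⟩ := Subgroup.mem_zpowers_iff.1 hx
    rw [← conj_zpow]
    refine zpow_mem ?_ k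
    obtain h | h | ⟨e, he, he7, he1⟩ := conj_t_sq hbS
    · rw [h, mul_inv_cancel_right]
      exact Subgroup.mem_zpowers _
    · rw [h, mul_inv_cancel_right]
      exact Subgroup.npow_mem_zpowers _ 2
    · have hle : Subgroup.closure {t ^ 2, b} ≤ M :=
        (Subgroup.closure_le M).2 (Set.insert_subset ha (Set.singleton_subset_iff.2 hb))
      exact absurd (h7 e (hle he) he7) he1
  refine isSupersolvable_inf_S_of_mem ha haS ?_ (fun g hg => ?_) fun g => mem_zpowers_t_sq
  · have : orderOf (t ^ 2) = 3 := orderOf_eq_prime (code_injective (by decide +kernel))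
      fun h => absurd (congrArg code h) (by decide)
    rw [this]
    decide
  · have ha' := Subgroup.mem_zpowers (t ^ 2)
    by_cases hgS : g ∈ S
    · obtain ⟨b, hb, hbS⟩ := SetLike.not_le_iff_exists.1 hS
      have := odd (g * b) (mul_mem hg hb) (fun h => hbS ((S.mul_mem_cancel_left hgS).1 h)) _
        (odd b⁻¹ (inv_mem hb) (fun h => hbS (S.inv_mem_iff.1 h)) _ ha')
      rwa [show g * b * (b⁻¹ * t ^ 2 * b⁻¹⁻¹) * (g * b)⁻¹ = g * t ^ 2 * g⁻¹ by group] at this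
    · exact odd g hg hgS _ ha'

theorem isSupersolvable_inf_S {M : Subgroup PGL27} (hMS : ¬M ≤ S) (hSM : ¬S ≤ M) :
    IsSupersolvable ↥(M ⊓ S) := by
  by_cases h7 : ∃ e ∈ M, e ^ 7 = 1 ∧ e ≠ 1
  · obtain ⟨e, he, he7, he1⟩ := h7
    obtain ⟨h, hh⟩ := exists_conj_c he7 he1
    refine isSupersolvable_inf_S_of_conj h (isSupersolvable_inf_S_of_c_mem (fun hle => hSM ?_) ?_)
    · intro g hg
      have : h * (h⁻¹ * g * h) * h⁻¹ ∈ M :=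
        hle (by simpa using Subgroup.Normal.conj_mem inferInstance g hg h⁻¹)
      simpa only [mul_assoc, mul_inv_cancel_left, mul_inv_cancel, mul_one] using this
    · show h * c * h⁻¹ ∈ M
      rwa [hh, mul_inv_cancel_right]
  push Not at h7
  by_cases h3 : ∃ e ∈ M, e ^ 3 = 1 ∧ e ≠ 1
  · obtain ⟨e, he, he3, he1⟩ := h3
    obtain ⟨h, hh⟩ := exists_conj_t_sq he3 he1
    refine isSupersolvable_inf_S_of_conj h
      (isSupersolvable_inf_S_of_t_sq_mem (fun hle => hMS ?_) (fun e he he7 => ?_) ?_)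
    · intro g hg
      have : h⁻¹ * g * h ∈ S := hle (show h * (h⁻¹ * g * h) * h⁻¹ ∈ M by
        simpa only [mul_assoc, mul_inv_cancel_left, mul_inv_cancel, mul_one] using hg)
      have := Subgroup.Normal.conj_mem inferInstance _ this h
      simpa only [mul_assoc, mul_inv_cancel_left, mul_inv_cancel, mul_one] using this
    · have : h * e * h⁻¹ = 1 := h7 _ he (by rw [conj_pow, he7, mul_one, mul_inv_cancel])
      exact conj_eq_one_iff.1 this
    · show h * t ^ 2 * h⁻¹ ∈ M
      rwa [hh, mul_inv_cancel_right]
  push Not at h3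
  have : Fact (Nat.Prime 2) := ⟨Nat.prime_two⟩
  refine IsSupersolvable.of_isPGroup (p := 2) fun g => ⟨3, Subtype.ext ?_⟩
  change (g : PGL27) ^ 8 = 1
  obtain h | h | h := pow_eight_or_six_or_seven g
  · exact h
  · have := h3 _ (pow_mem g.2.1 2) (by rw [← pow_mul, h])
    exact (pow_mul (g : PGL27) 2 4).trans (by rw [this, one_pow])
  · rw [h7 _ g.2.1 h, one_pow]

theorem isSupersolvable_cSection {M L K : Subgroup PGL27} (hM : IsCoatom M)
    (hcf : IsChiefFactor L K) (hLM : L ≤ M) (hKM : ¬K ≤ M) [L.Normal] :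
    IsSupersolvable (↥(M ⊓ K) ⧸ L.subgroupOf (M ⊓ K)) := by
  obtain ⟨-, hK, hlt, hmin⟩ := hcf
  by_cases hL : L = ⊥
  · subst hL
    have hSK : S ≤ K := S_le_of_normal hlt.ne'
    obtain rfl : S = K := by
      by_contra hne
      exact hmin S inferInstance (bot_lt_iff_ne_bot.2 S_ne_bot) (lt_of_le_of_ne hSK hne)
    refine (isSupersolvable_inf_S (fun h => ?_) hKM).of_surjective_s7 _
      (QuotientGroup.mk'_surjective _)
    exact hKM ((hM.le_iff_eq S_ne_top).1 h).le
  · have hSL : S ≤ L := S_le_of_normal hL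
    have hMS : M ≤ S := by
      intro b hb
      by_contra hbS
      refine hM.1 ((Subgroup.eq_top_iff' M).2 fun g => ?_)
      by_cases hgS : g ∈ S
      · exact hLM (hSL hgS)
      · rw [← inv_mul_cancel_right g b]
        exact mul_mem (hLM (hSL (mul_inv_mem_S hgS hbS))) hb
    have htop : L.subgroupOf (M ⊓ K) = ⊤ :=
      Subgroup.subgroupOf_eq_top.2 (inf_le_left.trans (hMS.trans hSL))
    have := QuotientGroup.subsingleton_iff.2 htop
    exact IsSupersolvable.of_isCyclic _

end PGL27
end ProjectiveLine

/-- There is a finite non-solvable group all of whose maximal subgroups have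
supersolvable c-sections. -/
theorem statement7 :
    ∃ (G : Type) (_ : Group G) (_ : Finite G),
      ¬IsSolvable G ∧
        ∀ M : Subgroup G, IsCoatom M →
          ∀ L K : Subgroup G, ∀ hcf : IsChiefFactor L K, L ≤ M → ¬K ≤ M →
            haveI : L.Normal := hcf.1
            IsSupersolvable (↥(M ⊓ K) ⧸ L.subgroupOf (M ⊓ K)) := by
  exact ⟨ProjectiveLine.PGL27, inferInstance, inferInstance,
    ProjectiveLine.PGL27.not_isSolvable, fun M hM L K hcf hLM hKM =>
      haveI : L.Normal := hcf.1
      ProjectiveLine.PGL27.isSupersolvable_cSection hM hcf hLM hKM⟩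
end
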